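/- arXiv:2507.21495 — 3 statements merged into one kernel-verified Lean document; each statement's English description precedes it below -/
import Mathlib

section
/- Let M ∈ Sᵐ have spectral decomposition M = U Λ Uᵀ with eigenvalues in nonincreasing order, and let α, β, γ be the index sets of positive, zero and negative eigenvalues of M, with U = [U_α, U_β, U_γ] partitioned accordingly. Define 𝓑(λ)_{ij} = (max{λᵢ,0} + max{λⱼ,0})/(|λᵢ| + |λⱼ|), where 0/0 := 1, evaluated at the eigenvalues of −M in the ordering given by U. Then: for every V ∈ ∂Π_{Sᵐ₊}(−M) there exists V_{|β|} ∈ ∂Π_{S^{|β|}₊}(0) such that for every H ∈ Sᵐ, writing H̃ = Uᵀ H U, V[H] = U · [[0, 0, 𝓑_{αγ} ⊙ H̃_{αγ}], [0, V_{|β|}[H̃_{ββ}], H̃_{βγ}], [(𝓑_{αγ})ᵀ ⊙ H̃_{αγ}ᵀ, H̃_{βγ}ᵀ, H̃_{γγ}]] · Uᵀ, where ⊙ is the entrywise (Hadamard) product. Conversely, for every V_{|β|} ∈ ∂Π_{S^{|β|}₊}(0) there exists V ∈ ∂Π_{Sᵐ₊}(−M) such that this identity holds. -/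
open Matrix Filter Topology Set

attribute [local instance] Matrix.normedAddCommGroup Matrix.normedSpace

noncomputable section

/-- Frobenius inner product `⟨A,B⟩ = tr(AᵀB)`. -/
def finner {m : ℕ} (A B : Matrix (Fin m) (Fin m) ℝ) : ℝ := (Aᵀ * B).trace

/-- Squared Frobenius norm. -/
def frobSq {m : ℕ} (A : Matrix (Fin m) (Fin m) ℝ) : ℝ := finner A A

/-- Frobenius norm. -/
def frobNorm {m : ℕ} (A : Matrix (Fin m) (Fin m) ℝ) : ℝ := Real.sqrt (frobSq A)

/-- Squared Euclidean norm on ℝⁿ. -/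
def euclNormSq {n : ℕ} (v : Fin n → ℝ) : ℝ := ∑ i, v i ^ 2

/-- Euclidean norm on ℝⁿ. -/
def euclNorm {n : ℕ} (v : Fin n → ℝ) : ℝ := Real.sqrt (euclNormSq v)

/-- Projection of a symmetric matrix onto the PSD cone (junk value `0` elsewhere). -/
def psdProj {m : ℕ} (M : Matrix (Fin m) (Fin m) ℝ) : Matrix (Fin m) (Fin m) ℝ :=
  if h : M.IsHermitian then
    (h.eigenvectorUnitary : Matrix (Fin m) (Fin m) ℝ) *
      diagonal (fun i => max (h.eigenvalues i) 0) *
      star (h.eigenvectorUnitary : Matrix (Fin m) (Fin m) ℝ)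
  else 0

/-- Moore-Penrose pseudoinverse of a symmetric matrix (junk value `0` elsewhere). -/
def symPinv {m : ℕ} (M : Matrix (Fin m) (Fin m) ℝ) : Matrix (Fin m) (Fin m) ℝ :=
  if h : M.IsHermitian then
    (h.eigenvectorUnitary : Matrix (Fin m) (Fin m) ℝ) *
      diagonal (fun i => (h.eigenvalues i)⁻¹) *
      star (h.eigenvectorUnitary : Matrix (Fin m) (Fin m) ℝ)
  else 0

/-- Symmetric part of a matrix. -/
def symPart {m : ℕ} (M : Matrix (Fin m) (Fin m) ℝ) : Matrix (Fin m) (Fin m) ℝ :=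
  (1/2 : ℝ) • (M + Mᵀ)

/-- The orthogonal projection onto the PSD cone, as a (Lipschitz) map on matrix space;
on symmetric matrices it coincides with `psdProj`. -/
def psdProjMap {m : ℕ} (M : Matrix (Fin m) (Fin m) ℝ) : Matrix (Fin m) (Fin m) ℝ :=
  psdProj (symPart M)

/-- Jordan product `A ∘ B = (AB + BA)/2`. -/
def jordan {m : ℕ} (A B : Matrix (Fin m) (Fin m) ℝ) : Matrix (Fin m) (Fin m) ℝ :=
  (1/2 : ℝ) • (A * B + B * A)

/-- Clarke subdifferential of a map between normed spaces: the convex hull of all limits of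
derivatives along sequences of differentiability points converging to `x`. -/
def clarkeSubdiff {E F : Type*} [NormedAddCommGroup E] [NormedSpace ℝ E]
    [NormedAddCommGroup F] [NormedSpace ℝ F] (f : E → F) (x : E) : Set (E →L[ℝ] F) :=
  convexHull ℝ {V | ∃ u : ℕ → E, (∀ k, DifferentiableAt ℝ f (u k)) ∧
    Tendsto u atTop (𝓝 x) ∧ Tendsto (fun k => fderiv ℝ f (u k)) atTop (𝓝 V)}

/-- `i`-th partial derivative of a matrix-valued map. -/
def pdG {n m : ℕ} (G : (Fin n → ℝ) → Matrix (Fin m) (Fin m) ℝ) (x : Fin n → ℝ) (i : Fin n) :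
    Matrix (Fin m) (Fin m) ℝ := fderiv ℝ G x (Pi.single i 1)

/-- Euclidean gradient of a scalar function on ℝⁿ. -/
def grad {n : ℕ} (φ : (Fin n → ℝ) → ℝ) (x : Fin n → ℝ) : Fin n → ℝ :=
  fun i => fderiv ℝ φ x (Pi.single i 1)

/-- Hessian matrix of a scalar function on ℝⁿ. -/
def hess {n : ℕ} (φ : (Fin n → ℝ) → ℝ) (x : Fin n → ℝ) : Matrix (Fin n) (Fin n) ℝ :=
  Matrix.of fun i j => fderiv ℝ (fun y => fderiv ℝ φ y (Pi.single j 1)) x (Pi.single i 1)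

/-- Quadratic form `dᵀ M d`. -/
def quadForm {n : ℕ} (M : Matrix (Fin n) (Fin n) ℝ) (d : Fin n → ℝ) : ℝ :=
  ∑ i, ∑ j, d i * M i j * d j

/-- The Lagrangian `L(x,μ,Ω) = f(x) − ⟨h(x),μ⟩ − ⟨G(x),Ω⟩`. -/
def Lag {n p m : ℕ} (f : (Fin n → ℝ) → ℝ) (h : (Fin n → ℝ) → (Fin p → ℝ))
    (G : (Fin n → ℝ) → Matrix (Fin m) (Fin m) ℝ)
    (x : Fin n → ℝ) (μ : Fin p → ℝ) (Ω : Matrix (Fin m) (Fin m) ℝ) : ℝ :=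
  f x - (∑ j, h x j * μ j) - finner (G x) Ω

/-- `∇ₓL(x,μ,Ω)`. -/
def gradLag {n p m : ℕ} (f : (Fin n → ℝ) → ℝ) (h : (Fin n → ℝ) → (Fin p → ℝ))
    (G : (Fin n → ℝ) → Matrix (Fin m) (Fin m) ℝ)
    (x : Fin n → ℝ) (μ : Fin p → ℝ) (Ω : Matrix (Fin m) (Fin m) ℝ) : Fin n → ℝ :=
  grad (fun y => Lag f h G y μ Ω) x

/-- `∇²ₓₓL(x,μ,Ω)`. -/
def hessLag {n p m : ℕ} (f : (Fin n → ℝ) → ℝ) (h : (Fin n → ℝ) → (Fin p → ℝ))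
    (G : (Fin n → ℝ) → Matrix (Fin m) (Fin m) ℝ)
    (x : Fin n → ℝ) (μ : Fin p → ℝ) (Ω : Matrix (Fin m) (Fin m) ℝ) :
    Matrix (Fin n) (Fin n) ℝ :=
  hess (fun y => Lag f h G y μ Ω) x

/-- The sigma-term `σ(x,Ω)ᵢⱼ = 2⟨Ω, ∂ᵢG(x) G(x)† ∂ⱼG(x)⟩`. -/
def sigmaMat {n m : ℕ} (G : (Fin n → ℝ) → Matrix (Fin m) (Fin m) ℝ)
    (x : Fin n → ℝ) (Ω : Matrix (Fin m) (Fin m) ℝ) : Matrix (Fin n) (Fin n) ℝ :=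
  Matrix.of fun i j => 2 * finner Ω (pdG G x i * symPinv (G x) * pdG G x j)

/-- Feasibility for the NSDP. -/
def Feasible {n p m : ℕ} (h : (Fin n → ℝ) → (Fin p → ℝ))
    (G : (Fin n → ℝ) → Matrix (Fin m) (Fin m) ℝ) (x : Fin n → ℝ) : Prop :=
  h x = 0 ∧ (G x).PosSemidef

/-- An AKKT sequence corresponding to `xb`. -/
def IsAKKTSeq {n p m : ℕ} (f : (Fin n → ℝ) → ℝ) (h : (Fin n → ℝ) → (Fin p → ℝ))
    (G : (Fin n → ℝ) → Matrix (Fin m) (Fin m) ℝ) (xb : Fin n → ℝ)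
    (x : ℕ → Fin n → ℝ) (μ : ℕ → Fin p → ℝ) (Ω : ℕ → Matrix (Fin m) (Fin m) ℝ) : Prop :=
  (∀ k, (Ω k).PosSemidef) ∧
  Tendsto x atTop (𝓝 xb) ∧
  Tendsto (fun k => gradLag f h G (x k) (μ k) (Ω k)) atTop (𝓝 0) ∧
  ∃ (U : Matrix (Fin m) (Fin m) ℝ) (Uk : ℕ → Matrix (Fin m) (Fin m) ℝ)
    (lam : Fin m → ℝ) (lamk : ℕ → Fin m → ℝ),
      Uᵀ * U = 1 ∧ (∀ k, (Uk k)ᵀ * Uk k = 1) ∧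
      Tendsto Uk atTop (𝓝 U) ∧
      G xb = U * diagonal lam * Uᵀ ∧
      (∀ k, Ω k = Uk k * diagonal (lamk k) * (Uk k)ᵀ) ∧
      (∀ j, 0 < lam j → ∃ kj, ∀ k ≥ kj, lamk k j = 0)

/-- A CAKKT sequence corresponding to `xb`. -/
def IsCAKKTSeq {n p m : ℕ} (f : (Fin n → ℝ) → ℝ) (h : (Fin n → ℝ) → (Fin p → ℝ))
    (G : (Fin n → ℝ) → Matrix (Fin m) (Fin m) ℝ) (xb : Fin n → ℝ)
    (x : ℕ → Fin n → ℝ) (μ : ℕ → Fin p → ℝ) (Ω : ℕ → Matrix (Fin m) (Fin m) ℝ) : Prop :=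
  (∀ k, (Ω k).PosSemidef) ∧
  Tendsto x atTop (𝓝 xb) ∧
  Tendsto (fun k => gradLag f h G (x k) (μ k) (Ω k)) atTop (𝓝 0) ∧
  Tendsto (fun k => jordan (G (x k)) (Ω k)) atTop (𝓝 0)

/-- An AKKT point. -/
def IsAKKTPoint {n p m : ℕ} (f : (Fin n → ℝ) → ℝ) (h : (Fin n → ℝ) → (Fin p → ℝ))
    (G : (Fin n → ℝ) → Matrix (Fin m) (Fin m) ℝ) (xb : Fin n → ℝ) : Prop :=
  Feasible h G xb ∧ ∃ (x : ℕ → Fin n → ℝ) (μ : ℕ → Fin p → ℝ) (Ω : ℕ → Matrix (Fin m) (Fin m) ℝ), IsAKKTSeq f h G xb x μ Ω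

/-- A CAKKT point. -/
def IsCAKKTPoint {n p m : ℕ} (f : (Fin n → ℝ) → ℝ) (h : (Fin n → ℝ) → (Fin p → ℝ))
    (G : (Fin n → ℝ) → Matrix (Fin m) (Fin m) ℝ) (xb : Fin n → ℝ) : Prop :=
  Feasible h G xb ∧ ∃ (x : ℕ → Fin n → ℝ) (μ : ℕ → Fin p → ℝ) (Ω : ℕ → Matrix (Fin m) (Fin m) ℝ), IsCAKKTSeq f h G xb x μ Ω

/-- `U` is a matrix whose columns form an orthonormal basis of `ker A`. -/
def IsONKernelBasis {m r : ℕ} (A : Matrix (Fin m) (Fin m) ℝ)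
    (U : Matrix (Fin m) (Fin r) ℝ) : Prop :=
  Uᵀ * U = 1 ∧
  Submodule.span ℝ (Set.range fun i : Fin r => (fun j => U j i)) = LinearMap.ker A.mulVecLin

/-- The columns of `Q` form an orthonormal basis of the span of eigenvectors of `A`
associated with its `r` smallest eigenvalues. -/
def SpansSmallestEigenspace {m r : ℕ} (A : Matrix (Fin m) (Fin m) ℝ)
    (Q : Matrix (Fin m) (Fin r) ℝ) : Prop :=
  Qᵀ * Q = 1 ∧
  ∃ ν : Fin r → ℝ,
    (∀ i, A *ᵥ (fun j => Q j i) = ν i • (fun j => Q j i)) ∧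
    (∀ (c : ℝ) (w : Fin m → ℝ), w ≠ 0 → A *ᵥ w = c • w →
      (∀ i, w ⬝ᵥ (fun j => Q j i) = 0) → ∀ i, ν i ≤ c)

/-- The perturbed critical subspace `S(x, x̄)`, defined through the analytic map `𝒰`. -/
def pertCritSubspace {n p m r : ℕ} (h : (Fin n → ℝ) → (Fin p → ℝ))
    (G : (Fin n → ℝ) → Matrix (Fin m) (Fin m) ℝ)
    (𝒰 : Matrix (Fin m) (Fin m) ℝ → Matrix (Fin m) (Fin r) ℝ) (x : Fin n → ℝ) :
    Set (Fin n → ℝ) :=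
  {d | fderiv ℝ h x d = 0 ∧ (𝒰 (G x))ᵀ * (fderiv ℝ G x d) * 𝒰 (G x) = 0}

/-- The critical subspace `S(x̄)`. -/
def critSubspace {n p m r : ℕ} (h : (Fin n → ℝ) → (Fin p → ℝ))
    (G : (Fin n → ℝ) → Matrix (Fin m) (Fin m) ℝ)
    (Ub : Matrix (Fin m) (Fin r) ℝ) (xb : Fin n → ℝ) : Set (Fin n → ℝ) :=
  {d | fderiv ℝ h xb d = 0 ∧ Ubᵀ * (fderiv ℝ G xb d) * Ub = 0}

/-- The data of Lemma (Bonnans–Shapiro): an open neighborhood `N` of `G(x̄)` and an analytic map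
`𝒰` with `𝒰(G(x̄)) = U_β̄` whose columns, at symmetric `A ∈ N`, form an orthonormal basis of the
span of eigenvectors of the `|β̄|` smallest eigenvalues of `A`. -/
def IsEigenbasisMap {n m r : ℕ} (G : (Fin n → ℝ) → Matrix (Fin m) (Fin m) ℝ)
    (xb : Fin n → ℝ) (Ub : Matrix (Fin m) (Fin r) ℝ) (N : Set (Matrix (Fin m) (Fin m) ℝ))
    (𝒰 : Matrix (Fin m) (Fin m) ℝ → Matrix (Fin m) (Fin r) ℝ) : Prop :=
  IsOpen N ∧ G xb ∈ N ∧ AnalyticOnNhd ℝ 𝒰 N ∧ 𝒰 (G xb) = Ub ∧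
  IsONKernelBasis (G xb) Ub ∧
  (∀ A ∈ N, A.IsHermitian → SpansSmallestEigenspace A (𝒰 A))

/-- The vectors `v̄ᵢⱼ(x)` appearing in the WCR property. -/
def vbar {n m r : ℕ} (G : (Fin n → ℝ) → Matrix (Fin m) (Fin m) ℝ)
    (𝒰 : Matrix (Fin m) (Fin m) ℝ → Matrix (Fin m) (Fin r) ℝ)
    (x : Fin n → ℝ) (i j : Fin r) : Fin n → ℝ :=
  fun ℓ => (fun s => 𝒰 (G x) s i) ⬝ᵥ (pdG G x ℓ *ᵥ (fun s => 𝒰 (G x) s j))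

/-- The weak constant rank (WCR) property at `x̄`. -/
def WCRat {n p m r : ℕ} (h : (Fin n → ℝ) → (Fin p → ℝ))
    (G : (Fin n → ℝ) → Matrix (Fin m) (Fin m) ℝ)
    (𝒰 : Matrix (Fin m) (Fin m) ℝ → Matrix (Fin m) (Fin r) ℝ)
    (xb : Fin n → ℝ) : Prop :=
  ∃ N' ∈ 𝓝 xb, ∃ ρ : ℕ, ∀ x ∈ N',
    Module.finrank ℝ (Submodule.span ℝ
      ({v | ∃ i j : Fin r, i ≤ j ∧ v = vbar G 𝒰 x i j} ∪
       {v | ∃ i : Fin p, v = grad (fun y => h y i) x})) = ρ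

/-- Robinson's constraint qualification at `x̄`. -/
def RobinsonCQ {n p m : ℕ} (h : (Fin n → ℝ) → (Fin p → ℝ))
    (G : (Fin n → ℝ) → Matrix (Fin m) (Fin m) ℝ) (xb : Fin n → ℝ) : Prop :=
  Function.Surjective (fun d => fderiv ℝ h xb d) ∧
  ∃ d : Fin n → ℝ, fderiv ℝ h xb d = 0 ∧ (G xb + fderiv ℝ G xb d).PosDef

/-- The KKT conditions. -/
def IsKKT {n p m : ℕ} (f : (Fin n → ℝ) → ℝ) (h : (Fin n → ℝ) → (Fin p → ℝ))
    (G : (Fin n → ℝ) → Matrix (Fin m) (Fin m) ℝ)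
    (xb : Fin n → ℝ) (μb : Fin p → ℝ) (Ωb : Matrix (Fin m) (Fin m) ℝ) : Prop :=
  Feasible h G xb ∧ Ωb.PosSemidef ∧ gradLag f h G xb μb Ωb = 0 ∧ finner (G xb) Ωb = 0

/-- The second-order inequality along a sequence, on the perturbed critical subspaces. -/
def SecondOrderIneq {n p m r : ℕ} (f : (Fin n → ℝ) → ℝ) (h : (Fin n → ℝ) → (Fin p → ℝ))
    (G : (Fin n → ℝ) → Matrix (Fin m) (Fin m) ℝ)
    (𝒰 : Matrix (Fin m) (Fin m) ℝ → Matrix (Fin m) (Fin r) ℝ)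
    (x : ℕ → Fin n → ℝ) (μ : ℕ → Fin p → ℝ) (Ω : ℕ → Matrix (Fin m) (Fin m) ℝ)
    (ε : ℕ → ℝ) (nb : ℕ) : Prop :=
  ∀ k ≥ nb, ∀ d ∈ pertCritSubspace h G 𝒰 (x k),
    quadForm (hessLag f h G (x k) (μ k) (Ω k) + sigmaMat G (x k) (Ω k)) d
      ≥ -(ε k) * euclNormSq d

/-- `x̄` is an AKKT2 point (relative to the eigenbasis map `𝒰`). -/
def IsAKKT2Point {n p m r : ℕ} (f : (Fin n → ℝ) → ℝ) (h : (Fin n → ℝ) → (Fin p → ℝ))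
    (G : (Fin n → ℝ) → Matrix (Fin m) (Fin m) ℝ)
    (𝒰 : Matrix (Fin m) (Fin m) ℝ → Matrix (Fin m) (Fin r) ℝ) (xb : Fin n → ℝ) : Prop :=
  Feasible h G xb ∧ ∃ (x : ℕ → Fin n → ℝ) (μ : ℕ → Fin p → ℝ) (Ω : ℕ → Matrix (Fin m) (Fin m) ℝ)
      (ε : ℕ → ℝ) (nb : ℕ),
    IsAKKTSeq f h G xb x μ Ω ∧ (∀ k, 0 < ε k) ∧ Tendsto ε atTop (𝓝 0) ∧
    SecondOrderIneq f h G 𝒰 x μ Ω ε nb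

/-- `x̄` is a CAKKT2 point (relative to the eigenbasis map `𝒰`). -/
def IsCAKKT2Point {n p m r : ℕ} (f : (Fin n → ℝ) → ℝ) (h : (Fin n → ℝ) → (Fin p → ℝ))
    (G : (Fin n → ℝ) → Matrix (Fin m) (Fin m) ℝ)
    (𝒰 : Matrix (Fin m) (Fin m) ℝ → Matrix (Fin m) (Fin r) ℝ) (xb : Fin n → ℝ) : Prop :=
  Feasible h G xb ∧ ∃ (x : ℕ → Fin n → ℝ) (μ : ℕ → Fin p → ℝ) (Ω : ℕ → Matrix (Fin m) (Fin m) ℝ)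
      (ε : ℕ → ℝ) (nb : ℕ),
    IsCAKKTSeq f h G xb x μ Ω ∧ (∀ k, 0 < ε k) ∧ Tendsto ε atTop (𝓝 0) ∧
    SecondOrderIneq f h G 𝒰 x μ Ω ε nb

/-- The constraint-violation measure `P(x) = ½(‖h(x)‖² + ‖Π(−G(x))‖_F²)`. -/
def constraintViol {n p m : ℕ} (h : (Fin n → ℝ) → (Fin p → ℝ))
    (G : (Fin n → ℝ) → Matrix (Fin m) (Fin m) ℝ) (x : Fin n → ℝ) : ℝ :=
  (1/2) * ((∑ j, (h x j)^2) + frobSq (psdProj (-(G x))))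

/-- The formula `∇P(x) = Dh(x)ᵀh(x) − DG(x)*[Π(−G(x))]`. -/
def gradPen {n p m : ℕ} (h : (Fin n → ℝ) → (Fin p → ℝ))
    (G : (Fin n → ℝ) → Matrix (Fin m) (Fin m) ℝ) (x : Fin n → ℝ) : Fin n → ℝ :=
  fun i => (∑ j, grad (fun y => h y j) x i * h x j) - finner (pdG G x i) (psdProj (-(G x)))

/-- Inner semicontinuity of a set-valued map at a point. -/
def InnerSemicontinuousAt {n : ℕ} (T : (Fin n → ℝ) → Set (Fin n → ℝ)) (xb : Fin n → ℝ) : Prop :=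
  ∀ O : Set (Fin n → ℝ), IsOpen O → (T xb ∩ O).Nonempty → ∀ᶠ y in 𝓝 xb, (T y ∩ O).Nonempty

/-- The tangent cone to the PSD cone at `A`. -/
def tangentConePSD {m : ℕ} (A : Matrix (Fin m) (Fin m) ℝ) : Set (Matrix (Fin m) (Fin m) ℝ) :=
  {D | ∃ (Dk : ℕ → Matrix (Fin m) (Fin m) ℝ) (a : ℕ → ℝ),
    (∀ k, (Dk k).IsHermitian) ∧ (∀ k, 0 < a k) ∧
    Tendsto Dk atTop (𝓝 D) ∧ Tendsto a atTop (𝓝 0) ∧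
    ∀ k, (A + a k • Dk k).PosSemidef}

/-- The critical cone `C(x̄)`. -/
def critCone {n p m : ℕ} (f : (Fin n → ℝ) → ℝ) (h : (Fin n → ℝ) → (Fin p → ℝ))
    (G : (Fin n → ℝ) → Matrix (Fin m) (Fin m) ℝ) (xb : Fin n → ℝ) : Set (Fin n → ℝ) :=
  {d | fderiv ℝ f xb d = 0 ∧ fderiv ℝ h xb d = 0 ∧
    fderiv ℝ G xb d ∈ tangentConePSD (G xb)}

/-- `𝓑(s,t) = (max{s,0} + max{t,0})/(|s| + |t|)`, with the convention `0/0 = 1`. -/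
def Bcal (s t : ℝ) : ℝ := if |s| + |t| = 0 then 1 else (max s 0 + max t 0) / (|s| + |t|)


/-- The block matrix appearing in Sun's characterization of `∂Π_{S^m_+}(−M)`:
rows/columns are grouped as `α = {i < a}` (positive eigenvalues of `M`),
`β = {a ≤ i < a + b}` (zero eigenvalues), `γ = {a + b ≤ i}` (negative eigenvalues). -/
def sunBlock {m : ℕ} (a : ℕ) (b : ℕ) (c : ℕ) (habc : a + b + c = m) (lam : Fin m → ℝ)
    (Vb : Matrix (Fin b) (Fin b) ℝ →L[ℝ] Matrix (Fin b) (Fin b) ℝ)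
    (Ht : Matrix (Fin m) (Fin m) ℝ) : Matrix (Fin m) (Fin m) ℝ :=
  Matrix.of fun i j =>
    if (i : ℕ) < a then
      (if (j : ℕ) < a + b then 0 else Bcal (-(lam i)) (-(lam j)) * Ht i j)
    else if hi : (i : ℕ) < a + b then
      (if hja : (j : ℕ) < a then 0
       else if hj : (j : ℕ) < a + b then
         Vb (Matrix.of fun s t : Fin b => Ht ⟨a + s, by omega⟩ ⟨a + t, by omega⟩)
           ⟨(i : ℕ) - a, by omega⟩ ⟨(j : ℕ) - a, by omega⟩
       else Ht i j)
    else
      (if (j : ℕ) < a then Bcal (-(lam j)) (-(lam i)) * Ht j i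
       else if (j : ℕ) < a + b then Ht j i
       else Ht i j)

/-! ### The positive semidefinite part of a symmetric matrix -/

lemma IsHermitian.eigenvectorUnitary_transpose_mul_self {m : ℕ} {X : Matrix (Fin m) (Fin m) ℝ}
    (hX : X.IsHermitian) :
    (hX.eigenvectorUnitary : Matrix (Fin m) (Fin m) ℝ)ᵀ * hX.eigenvectorUnitary = 1 := by
  have := Unitary.coe_star_mul_self hX.eigenvectorUnitary
  rwa [star_eq_conjTranspose, conjTranspose_eq_transpose_of_trivial] at this

lemma IsHermitian.eigenvectorUnitary_mul_diagonal_mul {m : ℕ} {X : Matrix (Fin m) (Fin m) ℝ}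
    (hX : X.IsHermitian) :
    (hX.eigenvectorUnitary : Matrix (Fin m) (Fin m) ℝ) * diagonal hX.eigenvalues *
      (hX.eigenvectorUnitary : Matrix (Fin m) (Fin m) ℝ)ᵀ = X := by
  have := hX.spectral_theorem
  rw [Unitary.conjStarAlgAut_apply, star_eq_conjTranspose,
    conjTranspose_eq_transpose_of_trivial] at this
  exact this.symm

lemma IsHermitian.exists_orthogonal_diagonal {m : ℕ} {X : Matrix (Fin m) (Fin m) ℝ}
    (hX : X.IsHermitian) :
    ∃ (Q : Matrix (Fin m) (Fin m) ℝ) (d : Fin m → ℝ), Qᵀ * Q = 1 ∧ X = Q * diagonal d * Qᵀ :=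
  ⟨hX.eigenvectorUnitary, hX.eigenvalues,
    IsHermitian.eigenvectorUnitary_transpose_mul_self hX,
    (IsHermitian.eigenvectorUnitary_mul_diagonal_mul hX).symm⟩

lemma PosSemidef.mul_mul_transpose {m p : ℕ} {Y : Matrix (Fin m) (Fin m) ℝ} (hY : Y.PosSemidef)
    (A : Matrix (Fin p) (Fin m) ℝ) : (A * Y * Aᵀ).PosSemidef := by
  have := hY.mul_mul_conjTranspose_same A
  rwa [conjTranspose_eq_transpose_of_trivial] at this

lemma PosSemidef.transpose_mul_mul {m p : ℕ} {Y : Matrix (Fin m) (Fin m) ℝ} (hY : Y.PosSemidef)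
    (A : Matrix (Fin m) (Fin p) ℝ) : (Aᵀ * Y * A).PosSemidef := by
  have := PosSemidef.mul_mul_transpose hY Aᵀ
  rwa [transpose_transpose] at this

lemma PosSemidef.transpose_eq {m : ℕ} {Y : Matrix (Fin m) (Fin m) ℝ} (hY : Y.PosSemidef) :
    Yᵀ = Y := by
  rw [← conjTranspose_eq_transpose_of_trivial]; exact hY.1

lemma PosSemidef.trace_mul_nonneg {m : ℕ} {Y Z : Matrix (Fin m) (Fin m) ℝ}
    (hY : Y.PosSemidef) (hZ : Z.PosSemidef) : 0 ≤ (Y * Z).trace := by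
  obtain ⟨Q, d, hQ, rfl⟩ := IsHermitian.exists_orthogonal_diagonal hY.1
  have hd : (diagonal d).PosSemidef := by
    have := PosSemidef.transpose_mul_mul hY Q
    have e : Qᵀ * (Q * diagonal d * Qᵀ) * Q = (Qᵀ * Q) * diagonal d * (Qᵀ * Q) := by
      simp only [Matrix.mul_assoc]
    rwa [e, hQ, Matrix.one_mul, Matrix.mul_one] at this
  have e : (Q * diagonal d * Qᵀ * Z).trace = (diagonal d * (Qᵀ * Z * Q)).trace := by
    rw [Matrix.mul_assoc, Matrix.mul_assoc, Matrix.trace_mul_comm]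
    simp only [Matrix.mul_assoc]
  rw [e, trace]
  refine Finset.sum_nonneg fun i _ => ?_
  rw [diag_apply, diagonal_mul]
  exact mul_nonneg (posSemidef_diagonal_iff.1 hd i)
    ((PosSemidef.transpose_mul_mul hZ Q).diag_nonneg)

/-- `Y` is the positive part in the Moreau decomposition `X = Y - (Y - X)`. -/
structure IsPsdPart {m : ℕ} (X Y : Matrix (Fin m) (Fin m) ℝ) : Prop where
  posSemidef : Y.PosSemidef
  sub_posSemidef : (Y - X).PosSemidef
  mul_sub : Y * (Y - X) = 0

lemma IsPsdPart.transpose_eq {m : ℕ} {X Y : Matrix (Fin m) (Fin m) ℝ} (h : IsPsdPart X Y) :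
    Xᵀ = X := by
  have h1 := PosSemidef.transpose_eq h.sub_posSemidef
  rw [transpose_sub, PosSemidef.transpose_eq h.posSemidef] at h1
  simpa using h1

lemma isPsdPart_diagonal {m : ℕ} (d : Fin m → ℝ) :
    IsPsdPart (diagonal d) (diagonal fun i => max (d i) 0) where
  posSemidef := PosSemidef.diagonal fun i => le_max_right _ _
  sub_posSemidef := by
    rw [diagonal_sub]
    exact PosSemidef.diagonal fun i => sub_nonneg.2 (le_max_left _ _)
  mul_sub := by
    rw [diagonal_sub, diagonal_mul_diagonal, ← diagonal_zero]
    congr 1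
    funext i
    rcases le_total (d i) 0 with h | h <;> simp [h]

lemma IsPsdPart.conj {m : ℕ} {X Y Q : Matrix (Fin m) (Fin m) ℝ} (h : IsPsdPart X Y)
    (hQ : Qᵀ * Q = 1) : IsPsdPart (Q * X * Qᵀ) (Q * Y * Qᵀ) where
  posSemidef := PosSemidef.mul_mul_transpose h.posSemidef Q
  sub_posSemidef := by
    have := PosSemidef.mul_mul_transpose h.sub_posSemidef Q
    rwa [Matrix.mul_sub, Matrix.sub_mul] at this
  mul_sub := by
    rw [← Matrix.sub_mul, ← Matrix.mul_sub]
    calc Q * Y * Qᵀ * (Q * (Y - X) * Qᵀ) = Q * (Y * (Qᵀ * Q) * (Y - X)) * Qᵀ := by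
          simp only [Matrix.mul_assoc]
      _ = 0 := by rw [hQ, Matrix.mul_one, h.mul_sub, Matrix.mul_zero, Matrix.zero_mul]

/-- Monotonicity of the positive part, in the form that yields nonexpansiveness. -/
lemma IsPsdPart.sum_sq_le {m : ℕ} {X Y X' Y' : Matrix (Fin m) (Fin m) ℝ} (h : IsPsdPart X Y)
    (h' : IsPsdPart X' Y') :
    ∑ i, ∑ j, (Y - Y') i j ^ 2 ≤ ∑ i, ∑ j, (Y - Y') i j * (X - X') i j := by
  have e1 : ∀ A B : Matrix (Fin m) (Fin m) ℝ, Bᵀ = B → (A * B).trace = ∑ i, ∑ j, A i j * B i j := by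
    intro A B hB
    simp only [trace, diag_apply, mul_apply]
    refine Finset.sum_congr rfl fun i _ => Finset.sum_congr rfl fun j _ => ?_
    rw [← hB, transpose_apply, hB]
  have hY := PosSemidef.transpose_eq h.posSemidef
  have hY' := PosSemidef.transpose_eq h'.posSemidef
  simp only [pow_two]
  rw [← e1 _ _ (by rw [transpose_sub, hY, hY']),
    ← e1 _ _ (by rw [transpose_sub, h.transpose_eq, h'.transpose_eq])]
  have t1 := PosSemidef.trace_mul_nonneg h.posSemidef h'.sub_posSemidef
  have t2 := PosSemidef.trace_mul_nonneg h'.posSemidef h.sub_posSemidef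
  have key : (Y - Y') * (Y - Y') - (Y - Y') * (X - X') =
      - (Y * (Y' - X')) - Y' * (Y - X) + Y * (Y - X) + Y' * (Y' - X') := by noncomm_ring
  have := congrArg trace key
  rw [h.mul_sub, h'.mul_sub] at this
  simp only [trace_sub, trace_add, trace_neg, trace_zero] at this
  linarith

lemma IsPsdPart.norm_sub_le {m : ℕ} {X Y X' Y' : Matrix (Fin m) (Fin m) ℝ} (h : IsPsdPart X Y)
    (h' : IsPsdPart X' Y') : ‖Y - Y'‖ ≤ (m * m : ℝ) * ‖X - X'‖ := by
  have h1 := h.sum_sq_le h'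
  have hb : ∑ i, ∑ j, (Y - Y') i j * (X - X') i j ≤ (m * m : ℝ) * (‖Y - Y'‖ * ‖X - X'‖) := by
    calc ∑ i, ∑ j, (Y - Y') i j * (X - X') i j
        ≤ ∑ i : Fin m, ∑ j : Fin m, ‖Y - Y'‖ * ‖X - X'‖ := by
          refine Finset.sum_le_sum fun i _ => Finset.sum_le_sum fun j _ => ?_
          refine (le_abs_self _).trans ?_
          rw [abs_mul]
          exact mul_le_mul (norm_entry_le_entrywise_sup_norm (Y - Y'))
            (norm_entry_le_entrywise_sup_norm (X - X')) (abs_nonneg _) (norm_nonneg _)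
      _ = _ := by simp [mul_assoc]
  have hs : ‖Y - Y'‖ ≤ Real.sqrt (∑ i, ∑ j, (Y - Y') i j ^ 2) := by
    rw [norm_le_iff (Real.sqrt_nonneg _)]
    intro i j
    rw [Real.norm_eq_abs]
    apply Real.abs_le_sqrt
    refine le_trans ?_ (Finset.single_le_sum (f := fun i => ∑ j, (Y - Y') i j ^ 2)
      (fun i _ => Finset.sum_nonneg fun j _ => sq_nonneg _) (Finset.mem_univ i))
    exact Finset.single_le_sum (f := fun j => (Y - Y') i j ^ 2)
      (fun j _ => sq_nonneg _) (Finset.mem_univ j)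
  rcases (norm_nonneg (Y - Y')).eq_or_lt with h0 | h0
  · rw [← h0]; positivity
  · have h2 : ‖Y - Y'‖ ^ 2 ≤ ∑ i, ∑ j, (Y - Y') i j ^ 2 := (Real.le_sqrt' h0).1 hs
    nlinarith

lemma IsPsdPart.unique {m : ℕ} {X Y Y' : Matrix (Fin m) (Fin m) ℝ} (h : IsPsdPart X Y)
    (h' : IsPsdPart X Y') : Y = Y' := by
  have := h.norm_sub_le h'
  rw [sub_self, norm_zero, mul_zero] at this
  exact sub_eq_zero.1 (norm_le_zero_iff.1 this)

/-! ### Basic properties of `psdProjMap` -/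

lemma transpose_symPart {m : ℕ} (X : Matrix (Fin m) (Fin m) ℝ) : (symPart X)ᵀ = symPart X := by
  simp [symPart, add_comm]

lemma symPart_of_transpose_eq {m : ℕ} {X : Matrix (Fin m) (Fin m) ℝ} (h : Xᵀ = X) :
    symPart X = X := by
  rw [symPart, h, ← two_smul ℝ X, smul_smul]; norm_num

lemma symPart_add {m : ℕ} (X Y : Matrix (Fin m) (Fin m) ℝ) :
    symPart (X + Y) = symPart X + symPart Y := by
  simp only [symPart, transpose_add, ← smul_add]; congr 1; abel

lemma symPart_sub {m : ℕ} (X Y : Matrix (Fin m) (Fin m) ℝ) :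
    symPart (X - Y) = symPart X - symPart Y := by
  simp only [symPart, transpose_sub, ← smul_sub]; congr 1; abel

lemma symPart_smul {m : ℕ} (c : ℝ) (X : Matrix (Fin m) (Fin m) ℝ) :
    symPart (c • X) = c • symPart X := by
  simp only [symPart, transpose_smul, ← smul_add]; rw [smul_comm]

lemma symPart_mul_mul_transpose {m p : ℕ} (A : Matrix (Fin p) (Fin m) ℝ)
    (X : Matrix (Fin m) (Fin m) ℝ) : symPart (A * X * Aᵀ) = A * symPart X * Aᵀ := by
  simp only [symPart, transpose_mul, transpose_transpose, Matrix.mul_smul, Matrix.smul_mul,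
    Matrix.mul_add, Matrix.add_mul, Matrix.mul_assoc]

lemma isPsdPart_psdProjMap {m : ℕ} (X : Matrix (Fin m) (Fin m) ℝ) :
    IsPsdPart (symPart X) (psdProjMap X) := by
  have hX : (symPart X).IsHermitian := by
    rw [IsHermitian, conjTranspose_eq_transpose_of_trivial, transpose_symPart]
  have h := (isPsdPart_diagonal hX.eigenvalues).conj
    (IsHermitian.eigenvectorUnitary_transpose_mul_self hX)
  rw [IsHermitian.eigenvectorUnitary_mul_diagonal_mul hX] at h
  rwa [psdProjMap, psdProj, dif_pos hX, star_eq_conjTranspose,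
    conjTranspose_eq_transpose_of_trivial]

lemma psdProjMap_eq {m : ℕ} {X Y : Matrix (Fin m) (Fin m) ℝ} (h : IsPsdPart (symPart X) Y) :
    psdProjMap X = Y :=
  (isPsdPart_psdProjMap X).unique h

lemma transpose_psdProjMap {m : ℕ} (X : Matrix (Fin m) (Fin m) ℝ) :
    (psdProjMap X)ᵀ = psdProjMap X :=
  PosSemidef.transpose_eq (isPsdPart_psdProjMap X).posSemidef

lemma psdProjMap_congr {m : ℕ} {X Y : Matrix (Fin m) (Fin m) ℝ} (h : symPart X = symPart Y) :
    psdProjMap X = psdProjMap Y := by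
  rw [psdProjMap, h, psdProjMap]

lemma norm_symPart_le {m : ℕ} (X : Matrix (Fin m) (Fin m) ℝ) : ‖symPart X‖ ≤ ‖X‖ := by
  rw [symPart, norm_smul]
  have := norm_add_le X Xᵀ
  rw [Matrix.norm_transpose] at this
  norm_num
  linarith

lemma norm_psdProjMap_sub_le {m : ℕ} (X Y : Matrix (Fin m) (Fin m) ℝ) :
    ‖psdProjMap X - psdProjMap Y‖ ≤ (m * m : ℝ) * ‖X - Y‖ := by
  refine ((isPsdPart_psdProjMap X).norm_sub_le (isPsdPart_psdProjMap Y)).trans ?_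
  rw [← symPart_sub]
  exact mul_le_mul_of_nonneg_left (norm_symPart_le _) (by positivity)

lemma lipschitzWith_psdProjMap (m : ℕ) :
    LipschitzWith (m * m : NNReal) (psdProjMap (m := m)) := by
  refine LipschitzWith.of_dist_le_mul fun X Y => ?_
  rw [dist_eq_norm, dist_eq_norm]
  exact_mod_cast norm_psdProjMap_sub_le X Y

lemma psdProjMap_diagonal {m : ℕ} (d : Fin m → ℝ) :
    psdProjMap (diagonal d) = diagonal fun i => max (d i) 0 :=
  psdProjMap_eq (by
    rw [symPart_of_transpose_eq (diagonal_transpose d)]; exact isPsdPart_diagonal d)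

lemma psdProjMap_conj {m : ℕ} {Q : Matrix (Fin m) (Fin m) ℝ} (hQ : Qᵀ * Q = 1)
    (X : Matrix (Fin m) (Fin m) ℝ) : psdProjMap (Q * X * Qᵀ) = Q * psdProjMap X * Qᵀ :=
  psdProjMap_eq (by rw [symPart_mul_mul_transpose]; exact (isPsdPart_psdProjMap X).conj hQ)

/-! ### Derivatives of `psdProjMap` -/

/-- The map `X ↦ A X Aᵀ`. -/
def conjCLM {p q : ℕ} (A : Matrix (Fin p) (Fin q) ℝ) :
    Matrix (Fin q) (Fin q) ℝ →L[ℝ] Matrix (Fin p) (Fin p) ℝ :=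
  LinearMap.toContinuousLinearMap
    { toFun := fun X => A * X * Aᵀ
      map_add' := fun X Y => by rw [Matrix.mul_add, Matrix.add_mul]
      map_smul' := fun c X => by rw [Matrix.mul_smul, Matrix.smul_mul, RingHom.id_apply] }

@[simp] lemma conjCLM_apply {p q : ℕ} (A : Matrix (Fin p) (Fin q) ℝ)
    (X : Matrix (Fin q) (Fin q) ℝ) : conjCLM A X = A * X * Aᵀ := rfl

lemma continuous_conjCLM {p q : ℕ} :
    Continuous (conjCLM : Matrix (Fin p) (Fin q) ℝ → _) := by
  refine continuous_clm_apply.2 fun X => ?_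
  exact (continuous_id.matrix_mul continuous_const).matrix_mul continuous_id.matrix_transpose

lemma HasFDerivAt.psdProjMap_of_symPart_eq {m : ℕ} {X X' : Matrix (Fin m) (Fin m) ℝ}
    {V : Matrix (Fin m) (Fin m) ℝ →L[ℝ] Matrix (Fin m) (Fin m) ℝ}
    (h : HasFDerivAt psdProjMap V X) (hX : symPart X = symPart X') :
    HasFDerivAt psdProjMap V X' := by
  have e : (psdProjMap : Matrix (Fin m) (Fin m) ℝ → _) = fun Y => psdProjMap (Y + (X - X')) := by
    funext Y
    exact psdProjMap_congr (by rw [symPart_add, symPart_sub, hX, sub_self, add_zero])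
  rw [e]
  refine (hasFDerivAt_comp_add_right (X - X')).2 ?_
  rwa [add_sub_cancel]

lemma HasFDerivAt.psdProjMap_conj {m : ℕ} {X Q : Matrix (Fin m) (Fin m) ℝ}
    {V : Matrix (Fin m) (Fin m) ℝ →L[ℝ] Matrix (Fin m) (Fin m) ℝ}
    (h : HasFDerivAt psdProjMap V X) (hQ : Qᵀ * Q = 1) :
    HasFDerivAt psdProjMap ((conjCLM Q).comp (V.comp (conjCLM Qᵀ))) (Q * X * Qᵀ) := by
  have hQ' : Q * Qᵀ = 1 := mul_eq_one_comm.1 hQ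
  have e : (psdProjMap : Matrix (Fin m) (Fin m) ℝ → _) =
      conjCLM Q ∘ psdProjMap ∘ conjCLM Qᵀ := by
    funext Y
    simp only [Function.comp_apply, conjCLM_apply]
    rw [_root_.psdProjMap_conj (by rwa [transpose_transpose])]
    calc psdProjMap Y = (Q * Qᵀ) * psdProjMap Y * (Q * Qᵀ) := by simp [hQ']
      _ = _ := by simp only [Matrix.mul_assoc, transpose_transpose]
  have hx : conjCLM Qᵀ (Q * X * Qᵀ) = X := by
    rw [conjCLM_apply, transpose_transpose]
    calc Qᵀ * (Q * X * Qᵀ) * Q = (Qᵀ * Q) * X * (Qᵀ * Q) := by simp only [Matrix.mul_assoc]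
      _ = X := by simp [hQ]
  rw [e]
  refine (conjCLM Q).hasFDerivAt.comp _ (HasFDerivAt.comp _ ?_ (conjCLM Qᵀ).hasFDerivAt)
  rwa [hx]

lemma HasFDerivAt.tendsto_slope_psdProjMap {m : ℕ} {X : Matrix (Fin m) (Fin m) ℝ}
    {V : Matrix (Fin m) (Fin m) ℝ →L[ℝ] Matrix (Fin m) (Fin m) ℝ}
    (h : HasFDerivAt psdProjMap V X) (H : Matrix (Fin m) (Fin m) ℝ) :
    Tendsto (fun t : ℝ => t⁻¹ • (psdProjMap (X + t • H) - psdProjMap X)) (𝓝[≠] 0) (𝓝 (V H)) := by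
  have h1 := hasDerivAt_iff_tendsto_slope_zero.1 (h.hasLineDerivAt H)
  simp only [zero_add, zero_smul, add_zero] at h1
  exact h1

lemma HasFDerivAt.psdProjMap_transpose_apply {m : ℕ} {X : Matrix (Fin m) (Fin m) ℝ}
    {V : Matrix (Fin m) (Fin m) ℝ →L[ℝ] Matrix (Fin m) (Fin m) ℝ}
    (h : HasFDerivAt psdProjMap V X) (H : Matrix (Fin m) (Fin m) ℝ) : (V H)ᵀ = V H := by
  have h1 := h.tendsto_slope_psdProjMap H
  have h2 := (continuous_id.matrix_transpose.tendsto (V H)).comp h1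
  refine tendsto_nhds_unique h2 (h1.congr fun t => ?_)
  simp [transpose_psdProjMap]

/-- The derivative of the complementarity relation `Π(X) (Π(X) - X) = 0`. -/
lemma HasFDerivAt.psdProjMap_complementarity {m : ℕ} {X : Matrix (Fin m) (Fin m) ℝ}
    {V : Matrix (Fin m) (Fin m) ℝ →L[ℝ] Matrix (Fin m) (Fin m) ℝ}
    (h : HasFDerivAt psdProjMap V X) (H : Matrix (Fin m) (Fin m) ℝ) :
    V H * (psdProjMap X - symPart X) + psdProjMap X * (V H - symPart H) = 0 := by
  have h1 := h.tendsto_slope_psdProjMap H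
  have hl : Tendsto (fun t : ℝ => X + t • H) (𝓝[≠] 0) (𝓝 X) := by
    have : Tendsto (fun t : ℝ => X + t • H) (𝓝 0) (𝓝 (X + (0 : ℝ) • H)) :=
      Continuous.tendsto (by fun_prop) 0
    rw [zero_smul, add_zero] at this
    exact this.mono_left nhdsWithin_le_nhds
  have hs : Continuous (symPart : Matrix (Fin m) (Fin m) ℝ → _) := by
    unfold symPart; fun_prop
  have h2 : Tendsto (fun t : ℝ => psdProjMap (X + t • H) - symPart (X + t • H)) (𝓝[≠] 0)
      (𝓝 (psdProjMap X - symPart X)) :=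
    (((lipschitzWith_psdProjMap m).continuous.sub hs).tendsto X).comp hl
  have h3 := (h1.mul h2).add ((tendsto_const_nhds (x := psdProjMap X)).mul
    (h1.sub (tendsto_const_nhds (x := symPart H))))
  refine tendsto_nhds_unique h3 (tendsto_const_nhds.congr' ?_)
  filter_upwards [self_mem_nhdsWithin] with t ht
  have ht : t ≠ 0 := ht
  have e1 := (isPsdPart_psdProjMap X).mul_sub
  have e2 := (isPsdPart_psdProjMap (X + t • H)).mul_sub
  have e3 : symPart H = t⁻¹ • (symPart (X + t • H) - symPart X) := by
    rw [symPart_add, symPart_smul, add_sub_cancel_left, smul_smul, inv_mul_cancel₀ ht, one_smul]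
  rw [e3, ← smul_sub, Matrix.smul_mul, Matrix.mul_smul, ← smul_add]
  generalize psdProjMap (X + t • H) = Y' at *
  generalize symPart (X + t • H) = X' at *
  have : (Y' - psdProjMap X) * (Y' - X') + psdProjMap X * (Y' - psdProjMap X - (X' - symPart X))
      = Y' * (Y' - X') - psdProjMap X * (psdProjMap X - symPart X) := by noncomm_ring
  rw [this, e1, e2, sub_zero, smul_zero]

/-! ### Compression to an invariant coordinate block -/

lemma one_sub_two_smul_mul_self {m : ℕ} {P : Matrix (Fin m) (Fin m) ℝ} (hP : P * P = P) :
    (1 - (2 : ℝ) • P) * (1 - (2 : ℝ) • P) = 1 := by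
  simp only [Matrix.sub_mul, Matrix.mul_sub, Matrix.smul_mul, Matrix.mul_smul, hP, Matrix.one_mul,
    Matrix.mul_one]
  module

lemma psdProjMap_compress {m b : ℕ} {E : Matrix (Fin m) (Fin b) ℝ} (hE : Eᵀ * E = 1)
    {X : Matrix (Fin m) (Fin m) ℝ} (hX : E * Eᵀ * X = X * (E * Eᵀ)) :
    psdProjMap (Eᵀ * X * E) = Eᵀ * psdProjMap X * E := by
  have hP := isPsdPart_psdProjMap X
  have hPE : E * Eᵀ * E = E := by rw [Matrix.mul_assoc, hE, Matrix.mul_one]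
  have hPt : (E * Eᵀ)ᵀ = E * Eᵀ := by rw [transpose_mul, transpose_transpose]
  have hPP : (E * Eᵀ) * (E * Eᵀ) = E * Eᵀ := by rw [← Matrix.mul_assoc, hPE]
  set P := E * Eᵀ with hPdef
  have hSt : (1 - (2 : ℝ) • P)ᵀ = 1 - (2 : ℝ) • P := by
    rw [transpose_sub, transpose_smul, hPt, transpose_one]
  have hSS : (1 - (2 : ℝ) • P)ᵀ * (1 - (2 : ℝ) • P) = 1 := by
    rw [hSt, one_sub_two_smul_mul_self hPP]
  have hcomm : P * psdProjMap X = psdProjMap X * P := by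
    have h1 := psdProjMap_conj hSS X
    have h2 : (1 - (2 : ℝ) • P) * X * (1 - (2 : ℝ) • P)ᵀ = X := by
      rw [Matrix.sub_mul, Matrix.smul_mul, hX, ← Matrix.mul_smul, Matrix.one_mul]
      nth_rewrite 1 [← Matrix.mul_one X]
      rw [← Matrix.mul_sub, Matrix.mul_assoc, mul_eq_one_comm.1 hSS, Matrix.mul_one]
    rw [h2] at h1
    have h3 : psdProjMap X * (1 - (2 : ℝ) • P) = (1 - (2 : ℝ) • P) * psdProjMap X := by
      nth_rewrite 1 [h1]
      rw [Matrix.mul_assoc, hSS, Matrix.mul_one]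
    rw [Matrix.mul_sub, Matrix.sub_mul, Matrix.mul_one, Matrix.one_mul, sub_right_inj,
      Matrix.mul_smul, Matrix.smul_mul] at h3
    exact (smul_right_injective _ (two_ne_zero' ℝ) h3).symm
  have hsym : symPart (Eᵀ * X * E) = Eᵀ * symPart X * E := by
    simpa using symPart_mul_mul_transpose Eᵀ X
  apply psdProjMap_eq
  rw [hsym]
  refine ⟨PosSemidef.transpose_mul_mul hP.posSemidef E, ?_, ?_⟩
  · rw [← Matrix.sub_mul, ← Matrix.mul_sub]
    exact PosSemidef.transpose_mul_mul hP.sub_posSemidef E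
  · rw [← Matrix.sub_mul, ← Matrix.mul_sub]
    calc Eᵀ * psdProjMap X * E * (Eᵀ * (psdProjMap X - symPart X) * E)
        = Eᵀ * (psdProjMap X * P) * (psdProjMap X - symPart X) * E := by
          simp only [hPdef, Matrix.mul_assoc]
      _ = Eᵀ * P * (psdProjMap X * (psdProjMap X - symPart X)) * E := by
          rw [← hcomm]; simp only [Matrix.mul_assoc]
      _ = 0 := by rw [hP.mul_sub]; simp

lemma HasFDerivAt.psdProjMap_compress {m b : ℕ} {E : Matrix (Fin m) (Fin b) ℝ}
    (hE : Eᵀ * E = 1) {A : Matrix (Fin m) (Fin m) ℝ} (hA : E * Eᵀ * A = A * (E * Eᵀ))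
    {V : Matrix (Fin m) (Fin m) ℝ →L[ℝ] Matrix (Fin m) (Fin m) ℝ}
    (h : HasFDerivAt psdProjMap V A) :
    HasFDerivAt psdProjMap ((conjCLM Eᵀ).comp (V.comp (conjCLM E))) (Eᵀ * A * E) := by
  have e : (psdProjMap : Matrix (Fin b) (Fin b) ℝ → _) =
      fun Y => conjCLM Eᵀ (psdProjMap (conjCLM E (Y - Eᵀ * A * E) + A)) := by
    funext Y
    rw [conjCLM_apply, conjCLM_apply, transpose_transpose, ← _root_.psdProjMap_compress hE]
    · congr 1
      calc Y = Eᵀ * E * (Y - Eᵀ * A * E) * (Eᵀ * E) + Eᵀ * A * E := by simp [hE]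
        _ = _ := by simp only [Matrix.mul_add, Matrix.add_mul, Matrix.mul_assoc]
    · rw [Matrix.mul_add, Matrix.add_mul, hA]
      congr 1
      calc E * Eᵀ * (E * (Y - Eᵀ * A * E) * Eᵀ) = E * (Eᵀ * E) * (Y - Eᵀ * A * E) * Eᵀ := by
            simp only [Matrix.mul_assoc]
        _ = E * (Y - Eᵀ * A * E) * (Eᵀ * E) * Eᵀ := by simp only [hE, Matrix.mul_one]
        _ = _ := by simp only [Matrix.mul_assoc]
  rw [e]
  refine (conjCLM Eᵀ).hasFDerivAt.comp _ ?_
  have hin : HasFDerivAt (fun Y => conjCLM E (Y - Eᵀ * A * E) + A) (conjCLM E) (Eᵀ * A * E) :=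
    ((conjCLM E).hasFDerivAt.comp _ ((hasFDerivAt_id _).sub_const _)).add_const A
  refine HasFDerivAt.comp (g := psdProjMap) (Eᵀ * A * E) ?_ hin
  rwa [sub_self, map_zero, zero_add]

lemma HasFDerivAt.psdProjMap_compress_apply {m b : ℕ} {E : Matrix (Fin m) (Fin b) ℝ}
    (hE : Eᵀ * E = 1) {A : Matrix (Fin m) (Fin m) ℝ} (hA : E * Eᵀ * A = A * (E * Eᵀ))
    {V : Matrix (Fin m) (Fin m) ℝ →L[ℝ] Matrix (Fin m) (Fin m) ℝ}
    (h : HasFDerivAt psdProjMap V A) (H : Matrix (Fin m) (Fin m) ℝ) :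
    Eᵀ * V H * E = Eᵀ * V (E * (Eᵀ * H * E) * Eᵀ) * E := by
  have hPE : E * Eᵀ * E = E := by rw [Matrix.mul_assoc, hE, Matrix.mul_one]
  have hPt : (E * Eᵀ)ᵀ = E * Eᵀ := by rw [transpose_mul, transpose_transpose]
  have hPP : (E * Eᵀ) * (E * Eᵀ) = E * Eᵀ := by rw [← Matrix.mul_assoc, hPE]
  have hH : E * (Eᵀ * H * E) * Eᵀ = (E * Eᵀ) * H * (E * Eᵀ) := by simp only [Matrix.mul_assoc]
  rw [hH]
  have hout : ∀ K, (E * Eᵀ) * K = K * (E * Eᵀ) → Eᵀ * K * E = 0 → Eᵀ * V K * E = 0 := by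
    intro K hK hK0
    have h1 := h.tendsto_slope_psdProjMap K
    have h2 := ((conjCLM Eᵀ).continuous.tendsto _).comp h1
    simp only [conjCLM_apply, transpose_transpose] at h2
    refine tendsto_nhds_unique h2 (tendsto_const_nhds.congr fun t => ?_)
    simp only [Function.comp_apply, conjCLM_apply, transpose_transpose, Matrix.mul_smul,
      Matrix.smul_mul, Matrix.mul_sub, Matrix.sub_mul]
    rw [← _root_.psdProjMap_compress hE hA, ← _root_.psdProjMap_compress hE
      (by rw [Matrix.mul_add, Matrix.add_mul, hA, Matrix.mul_smul, hK, Matrix.smul_mul]),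
      Matrix.mul_add, Matrix.add_mul, Matrix.mul_smul, Matrix.smul_mul, hK0]
    simp
  set P := E * Eᵀ with hPdef
  set S := 1 - (2 : ℝ) • P with hSdef
  have hSt : Sᵀ = S := by
    rw [hSdef, transpose_sub, transpose_smul, hPt, transpose_one]
  have hSS : S * S = 1 := one_sub_two_smul_mul_self hPP
  have hSE : S * E = -E := by
    rw [hSdef, Matrix.sub_mul, Matrix.smul_mul, hPE, Matrix.one_mul]; module
  have hES : Eᵀ * S = -Eᵀ := by
    have := congrArg transpose hSE
    rwa [transpose_mul, hSt, transpose_neg] at this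
  have hSA : S * A * Sᵀ = A := by
    have : S * A = A * S := by
      rw [hSdef, Matrix.sub_mul, Matrix.mul_sub, Matrix.smul_mul, hA, Matrix.mul_smul]; simp
    rw [hSt, this, Matrix.mul_assoc, hSS, Matrix.mul_one]
  have hrefl : Eᵀ * V (S * H * S) * E = Eᵀ * V H * E := by
    have h1 := h.psdProjMap_conj (Q := S) (by rw [hSt, hSS])
    rw [hSA] at h1
    have h2 : V H = S * V (S * H * S) * S := by
      have := congrArg (fun L => L H) (h.unique h1)
      simpa [hSt] using this
    rw [h2]
    calc _ = (-Eᵀ) * V (S * H * S) * (-E) := by simp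
      _ = _ := by rw [← hES, ← hSE]; simp only [Matrix.mul_assoc]
  have hdec : (2 : ℝ) • (P * H * P) + (2 : ℝ) • ((1 - P) * H * (1 - P)) = H + S * H * S := by
    rw [hSdef]
    simp only [Matrix.mul_sub, Matrix.sub_mul, Matrix.smul_mul, Matrix.mul_smul, Matrix.one_mul,
      Matrix.mul_one]
    module
  have hK := hout ((1 - P) * H * (1 - P))
    (by
      have e1 : P * (1 - P) = 0 := by rw [Matrix.mul_sub, hPP, Matrix.mul_one, sub_self]
      have e2 : (1 - P) * P = 0 := by rw [Matrix.sub_mul, hPP, Matrix.one_mul, sub_self]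
      rw [Matrix.mul_assoc _ _ P, e2, Matrix.mul_zero, Matrix.mul_assoc (1 - P),
        ← Matrix.mul_assoc P, e1, Matrix.zero_mul])
    (by
      have e1 : (1 - P) * E = 0 := by rw [Matrix.sub_mul, hPE, Matrix.one_mul, sub_self]
      rw [Matrix.mul_assoc, Matrix.mul_assoc _ _ E, e1, Matrix.mul_zero, Matrix.mul_zero])
  have hfin := congrArg (fun K => Eᵀ * V K * E) hdec
  simp only [map_add, map_smul, Matrix.mul_add, Matrix.add_mul, Matrix.mul_smul,
    Matrix.smul_mul, hK, hrefl, smul_zero, add_zero] at hfin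
  rw [← two_smul ℝ] at hfin
  exact (smul_right_injective _ (two_ne_zero' ℝ) hfin).symm

/-! ### Differentiability of `psdProjMap` at nonsingular matrices -/

lemma differentiableAt_psdProjMap_diagonal {m : ℕ} {d : Fin m → ℝ} (hd : ∀ i, d i ≠ 0) :
    DifferentiableAt ℝ psdProjMap (diagonal d) := by
  set D := diagonal d with hD
  have hDt : symPart D = D := symPart_of_transpose_eq (diagonal_transpose d)
  set r : Matrix (Fin m) (Fin m) ℝ → Matrix (Fin m) (Fin m) ℝ := fun X =>
    (psdProjMap X - psdProjMap D) * (psdProjMap X - psdProjMap D - symPart (X - D)) with hr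
  have hident : ∀ X i j, (max (d i) 0 + (max (d j) 0 - d j)) *
      (psdProjMap X i j - psdProjMap D i j) = max (d i) 0 * symPart (X - D) i j - r X i j := by
    intro X i j
    have e1 := (isPsdPart_psdProjMap D).mul_sub
    have e2 := (isPsdPart_psdProjMap X).mul_sub
    have e3 : psdProjMap D * (psdProjMap X - psdProjMap D - symPart (X - D)) +
        (psdProjMap X - psdProjMap D) * (psdProjMap D - D) + r X = 0 := by
      rw [hDt] at e1
      calc _ = psdProjMap X * (psdProjMap X - symPart X) - psdProjMap D * (psdProjMap D - D) := by
            simp only [hr, symPart_sub, hDt]; noncomm_ring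
        _ = 0 := by rw [e1, e2, sub_zero]
    have e4 := congrFun (congrFun e3 i) j
    rw [psdProjMap_diagonal, hD, diagonal_sub] at e4
    simp only [Matrix.add_apply, diagonal_mul, mul_diagonal, Matrix.sub_apply, Matrix.zero_apply] at e4
    rw [psdProjMap_diagonal]
    linarith
  have hrO : ∀ i j, DifferentiableAt ℝ (fun X => r X i j) D := by
    intro i j
    have hO : (fun X => r X i j) =O[𝓝 D] fun X => ‖X - D‖ ^ 2 := by
      refine Asymptotics.IsBigO.of_bound (m * ((m * m) * (m * m + 1))) (Eventually.of_forall ?_)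
      intro X
      have hN := norm_psdProjMap_sub_le X D
      have hN' : ‖psdProjMap X - psdProjMap D - symPart (X - D)‖ ≤ (m * m + 1) * ‖X - D‖ := by
        refine (norm_sub_le _ _).trans ?_
        have := norm_symPart_le (X - D)
        linarith
      calc ‖r X i j‖ ≤ ∑ l : Fin m, ((m * m) * ‖X - D‖) * ((m * m + 1) * ‖X - D‖) := by
            simp only [hr, mul_apply]
            refine (norm_sum_le _ _).trans (Finset.sum_le_sum fun l _ => ?_)
            rw [norm_mul]
            exact mul_le_mul ((norm_entry_le_entrywise_sup_norm _).trans hN)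
              ((norm_entry_le_entrywise_sup_norm _).trans hN') (norm_nonneg _) (by positivity)
        _ = _ := by
            simp only [Finset.sum_const, Finset.card_univ, Fintype.card_fin, nsmul_eq_mul,
              norm_pow, norm_norm]
            ring
    exact (hO.hasFDerivAt one_lt_two).differentiableAt
  have hS : ∀ i j, DifferentiableAt ℝ (fun X : Matrix (Fin m) (Fin m) ℝ => symPart (X - D) i j) D := by
    intro i j
    have h1 : ∀ i j, DifferentiableAt ℝ (fun X : Matrix (Fin m) (Fin m) ℝ => X i j) D := fun i j =>
      differentiableAt_pi.1 (differentiableAt_pi.1 differentiableAt_id i) j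
    simp only [symPart, Matrix.smul_apply, Matrix.add_apply, transpose_apply, Matrix.sub_apply, smul_eq_mul]
    exact (((h1 i j).sub_const _).add ((h1 j i).sub_const _)).const_mul _
  have hentry : ∀ i j, max (d i) 0 + (max (d j) 0 - d j) ≠ 0 →
      DifferentiableAt ℝ (fun X => psdProjMap X i j) D := by
    intro i j hc
    have e : (fun X => psdProjMap X i j) = fun X => (max (d i) 0 + (max (d j) 0 - d j))⁻¹ *
        (max (d i) 0 * symPart (X - D) i j - r X i j) + psdProjMap D i j := by
      funext X
      rw [← hident, inv_mul_cancel_left₀ hc, sub_add_cancel]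
    rw [e]
    exact ((((hS i j).const_mul _).sub (hrO i j)).const_mul _).add_const _
  refine differentiableAt_pi.2 fun i => differentiableAt_pi.2 fun j => ?_
  by_cases hc : max (d i) 0 + (max (d j) 0 - d j) = 0
  · have e : (fun X : Matrix (Fin m) (Fin m) ℝ => psdProjMap X i j) =
        fun X => psdProjMap X j i := by
      funext X
      rw [← transpose_psdProjMap X, transpose_apply, transpose_psdProjMap]
    have hi : d i < 0 := by
      refine lt_of_le_of_ne ?_ (hd i)
      linarith [le_max_left (d i) 0, le_max_left (d j) 0]
    have := hentry j i (by
      have := le_max_right (d j) 0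
      have := le_max_right (d i) 0
      linarith)
    exact e ▸ this
  · exact hentry i j hc

lemma differentiableAt_psdProjMap_of_mulVec {m : ℕ} {A : Matrix (Fin m) (Fin m) ℝ} (hA : Aᵀ = A)
    (hinj : ∀ v, A *ᵥ v = 0 → v = 0) : DifferentiableAt ℝ psdProjMap A := by
  obtain ⟨Q, d, hQ, rfl⟩ := IsHermitian.exists_orthogonal_diagonal (X := A)
    (by rw [IsHermitian, conjTranspose_eq_transpose_of_trivial, hA])
  have hd : ∀ i, d i ≠ 0 := by
    intro i hi
    have h1 := hinj (Q *ᵥ Pi.single i 1) (by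
      rw [mulVec_mulVec, Matrix.mul_assoc, hQ, Matrix.mul_one, ← mulVec_mulVec]
      simp [hi])
    have h2 := congrArg (fun v => Qᵀ *ᵥ v) h1
    simp only [mulVec_mulVec, hQ, one_mulVec, mulVec_zero] at h2
    simpa using congrFun h2 i
  exact ((differentiableAt_psdProjMap_diagonal hd).hasFDerivAt.psdProjMap_conj hQ).differentiableAt

lemma eq_zero_of_mulVec_of_differentiableAt_psdProjMap {m : ℕ} {Y : Matrix (Fin m) (Fin m) ℝ}
    (hY : Yᵀ = Y) (h : DifferentiableAt ℝ psdProjMap Y) {v : Fin m → ℝ} (hv : Y *ᵥ v = 0) :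
    v = 0 := by
  by_contra hne
  obtain ⟨i, hi⟩ := Function.ne_iff.1 hne
  have hP := isPsdPart_psdProjMap Y
  rw [symPart_of_transpose_eq hY] at hP
  set P := psdProjMap Y with hPdef
  set K := vecMulVec v v with hK
  have hKt : Kᵀ = K := by rw [hK, transpose_vecMulVec]
  have hKpsd : K.PosSemidef := by simpa using posSemidef_vecMulVec_self_star v
  have hYK : Y * K = 0 := by rw [hK, mul_vecMulVec, hv]; ext; simp [vecMulVec_apply]
  have hPK : P * K = 0 := by
    have h1 : P * (P * K) = 0 := by
      have := congrArg (· * K) hP.mul_sub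
      simp only [Matrix.mul_sub, Matrix.sub_mul, Matrix.mul_assoc, hYK, Matrix.mul_zero, sub_zero,
        Matrix.zero_mul] at this
      exact this
    have h2 := conjTranspose_mul_self_mul_eq_zero P K
    rw [hP.posSemidef.1, Matrix.mul_assoc] at h2
    exact h2.1 h1
  have hKY : K * Y = 0 := by
    have := congrArg transpose hYK
    rwa [transpose_mul, hY, hKt, transpose_zero] at this
  have hKP : K * P = 0 := by
    have := congrArg transpose hPK
    rwa [transpose_mul, PosSemidef.transpose_eq hP.posSemidef, hKt, transpose_zero] at this
  have hform : ∀ t : ℝ, psdProjMap (Y + t • K) = P + max t 0 • K := by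
    intro t
    apply psdProjMap_eq
    rw [symPart_of_transpose_eq (by rw [transpose_add, transpose_smul, hY, hKt])]
    have hsub : P + max t 0 • K - (Y + t • K) = (P - Y) + (max t 0 - t) • K := by module
    refine ⟨hP.posSemidef.add (hKpsd.smul (le_max_right _ _)), ?_, ?_⟩
    · rw [hsub]
      exact hP.sub_posSemidef.add (hKpsd.smul (sub_nonneg.2 (le_max_left _ _)))
    · rw [hsub, Matrix.add_mul, Matrix.mul_add, Matrix.mul_add, hP.mul_sub]
      have hz : max t 0 * (max t 0 - t) = 0 := by
        rcases le_total t 0 with h | h <;> simp [h]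
      simp only [Matrix.mul_smul, Matrix.smul_mul, hPK, Matrix.mul_sub, hKP, hKY, smul_smul]
      rw [mul_comm, hz]
      simp
  have h1 := (h.hasFDerivAt.hasLineDerivAt K).differentiableAt
  have h2 : DifferentiableAt ℝ (fun t : ℝ => psdProjMap (Y + t • K) i i) 0 :=
    differentiableAt_pi.1 (differentiableAt_pi.1 h1 i) i
  have hvi : v i * v i ≠ 0 := mul_self_ne_zero.2 hi
  refine not_differentiableAt_abs_zero ?_
  have e : (abs : ℝ → ℝ) =
      fun t => 2 * ((psdProjMap (Y + t • K) i i - P i i) * (v i * v i)⁻¹) - t := by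
    funext t
    rw [hform]
    simp only [Matrix.add_apply, Matrix.smul_apply, hK, vecMulVec_apply, smul_eq_mul, add_sub_cancel_left]
    rw [mul_inv_cancel_right₀ hvi]
    rcases le_total t 0 with h | h
    · rw [abs_of_nonpos h, max_eq_right h]; ring
    · rw [abs_of_nonneg h, max_eq_left h]; ring
  rw [e]
  exact (((h2.sub_const _).mul_const _).const_mul _).sub differentiableAt_id

/-! ### Limits of derivatives -/

lemma isCompact_setOf_transpose_mul_self (m : ℕ) :
    IsCompact {Q : Matrix (Fin m) (Fin m) ℝ | Qᵀ * Q = 1} := by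
  have : ProperSpace (Matrix (Fin m) (Fin m) ℝ) := FiniteDimensional.proper ℝ _
  refine Metric.isCompact_of_isClosed_isBounded ?_ ?_
  · exact isClosed_eq (continuous_id.matrix_transpose.matrix_mul continuous_id) continuous_const
  · refine isBounded_iff_forall_norm_le.2 ⟨1, fun Q hQ => (norm_le_iff zero_le_one).2 fun i j => ?_⟩
    refine entry_norm_bound_of_unitary ?_ i j
    rw [mem_unitaryGroup_iff', star_eq_conjTranspose, conjTranspose_eq_transpose_of_trivial]
    exact hQ

lemma tendsto_fderiv_psdProjMap_complementarity {m : ℕ} {u : ℕ → Matrix (Fin m) (Fin m) ℝ}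
    {x : Matrix (Fin m) (Fin m) ℝ}
    {V : Matrix (Fin m) (Fin m) ℝ →L[ℝ] Matrix (Fin m) (Fin m) ℝ}
    (hu : ∀ k, DifferentiableAt ℝ psdProjMap (u k)) (hux : Tendsto u atTop (𝓝 x))
    (hV : Tendsto (fun k => fderiv ℝ psdProjMap (u k)) atTop (𝓝 V))
    (H : Matrix (Fin m) (Fin m) ℝ) :
    (V H)ᵀ = V H ∧ V H * (psdProjMap x - symPart x) + psdProjMap x * (V H - symPart H) = 0 := by
  have hVH : Tendsto (fun k => fderiv ℝ psdProjMap (u k) H) atTop (𝓝 (V H)) :=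
    ((ContinuousLinearMap.apply ℝ _ H).continuous.tendsto V).comp hV
  have hs : Continuous (symPart : Matrix (Fin m) (Fin m) ℝ → _) := by
    unfold symPart; fun_prop
  have hP : Continuous (psdProjMap : Matrix (Fin m) (Fin m) ℝ → _) :=
    (lipschitzWith_psdProjMap m).continuous
  constructor
  · have h2 := (continuous_id.matrix_transpose.tendsto (V H)).comp hVH
    exact tendsto_nhds_unique h2
      (hVH.congr fun k => ((hu k).hasFDerivAt.psdProjMap_transpose_apply H).symm)
  · have h3 := (hVH.mul (((hP.sub hs).tendsto x).comp hux)).add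
      (((hP.tendsto x).comp hux).mul (hVH.sub (tendsto_const_nhds (x := symPart H))))
    exact tendsto_nhds_unique h3
      (tendsto_const_nhds.congr fun k => ((hu k).hasFDerivAt.psdProjMap_complementarity H).symm)

lemma tendsto_clm_comp {E F G : Type*} [NormedAddCommGroup E] [NormedSpace ℝ E]
    [NormedAddCommGroup F] [NormedSpace ℝ F] [NormedAddCommGroup G] [NormedSpace ℝ G]
    {f : ℕ → F →L[ℝ] G} {g : ℕ → E →L[ℝ] F} {f₀ : F →L[ℝ] G} {g₀ : E →L[ℝ] F}
    (hf : Tendsto f atTop (𝓝 f₀)) (hg : Tendsto g atTop (𝓝 g₀)) :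
    Tendsto (fun k => (f k).comp (g k)) atTop (𝓝 (f₀.comp g₀)) :=
  (isBoundedBilinearMap_comp.continuous.tendsto (f₀, g₀)).comp (hf.prodMk_nhds hg)

/-- Limits of derivatives at orthogonal conjugates of matrices that leave the range of `E`
invariant compress to limits of derivatives of the smaller projection. -/
lemma tendsto_fderiv_psdProjMap_compress {m b : ℕ} {E : Matrix (Fin m) (Fin b) ℝ}
    (hE : Eᵀ * E = 1) {U : Matrix (Fin m) (Fin m) ℝ} {Q A : ℕ → Matrix (Fin m) (Fin m) ℝ}
    (hQ : ∀ k, (Q k)ᵀ * Q k = 1) (hQU : Tendsto Q atTop (𝓝 U))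
    (hA : ∀ k, E * Eᵀ * A k = A k * (E * Eᵀ))
    (hdiff : ∀ k, DifferentiableAt ℝ psdProjMap (Q k * A k * (Q k)ᵀ))
    {V : Matrix (Fin m) (Fin m) ℝ →L[ℝ] Matrix (Fin m) (Fin m) ℝ}
    (hV : Tendsto (fun k => fderiv ℝ psdProjMap (Q k * A k * (Q k)ᵀ)) atTop (𝓝 V)) :
    ∃ Vb : Matrix (Fin b) (Fin b) ℝ →L[ℝ] Matrix (Fin b) (Fin b) ℝ,
      (∀ k, DifferentiableAt ℝ psdProjMap (Eᵀ * A k * E)) ∧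
      Tendsto (fun k => fderiv ℝ psdProjMap (Eᵀ * A k * E)) atTop (𝓝 Vb) ∧
      ∀ H, Eᵀ * (Uᵀ * V (U * H * Uᵀ) * U) * E = Vb (Eᵀ * H * E) := by
  set L : ℕ → Matrix (Fin m) (Fin m) ℝ →L[ℝ] Matrix (Fin m) (Fin m) ℝ := fun k =>
    (conjCLM (Q k)ᵀ).comp ((fderiv ℝ psdProjMap (Q k * A k * (Q k)ᵀ)).comp (conjCLM (Q k)))
    with hL
  have hLA : ∀ k, HasFDerivAt psdProjMap (L k) (A k) := by
    intro k
    have h1 := (hdiff k).hasFDerivAt.psdProjMap_conj (Q := (Q k)ᵀ)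
      (by rw [transpose_transpose]; exact mul_eq_one_comm.1 (hQ k))
    rw [transpose_transpose] at h1
    have e : (Q k)ᵀ * (Q k * A k * (Q k)ᵀ) * Q k = A k := by
      calc _ = ((Q k)ᵀ * Q k) * A k * ((Q k)ᵀ * Q k) := by simp only [Matrix.mul_assoc]
        _ = A k := by simp [hQ k]
    rwa [e] at h1
  have hLlim : Tendsto L atTop (𝓝 ((conjCLM Uᵀ).comp (V.comp (conjCLM U)))) := by
    have c1 := (continuous_conjCLM.tendsto U).comp hQU
    have c2 := ((continuous_conjCLM.comp continuous_id.matrix_transpose).tendsto U).comp hQU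
    exact tendsto_clm_comp c2 (tendsto_clm_comp hV c1)
  set Vb := (conjCLM Eᵀ).comp (((conjCLM Uᵀ).comp (V.comp (conjCLM U))).comp (conjCLM E))
    with hVb
  have hfd := fun k => (hLA k).psdProjMap_compress hE (hA k)
  refine ⟨Vb, fun k => (hfd k).differentiableAt, ?_, fun H => ?_⟩
  · refine Tendsto.congr (fun k => (hfd k).fderiv.symm) ?_
    exact tendsto_clm_comp tendsto_const_nhds (tendsto_clm_comp hLlim tendsto_const_nhds)
  · have happ : ∀ K, Tendsto (fun k => Eᵀ * L k K * E) atTop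
        (𝓝 (Eᵀ * (Uᵀ * V (U * K * Uᵀ) * U) * E)) := by
      intro K
      have h1 := ((ContinuousLinearMap.apply ℝ _ K).continuous.tendsto _).comp hLlim
      have h2 : Tendsto (fun k => conjCLM Eᵀ (L k K)) atTop
          (𝓝 (conjCLM Eᵀ (conjCLM Uᵀ (V (conjCLM U K))))) :=
        ((conjCLM Eᵀ).continuous.tendsto _).comp h1
      simpa only [conjCLM_apply, transpose_transpose] using h2
    have h3 := tendsto_nhds_unique (happ H)
      ((happ (E * (Eᵀ * H * E) * Eᵀ)).congr fun k =>
        ((hLA k).psdProjMap_compress_apply hE (hA k) H).symm)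
    rw [h3]
    simp [hVb]

/-! ### The block of zero eigenvalues -/

/-- The coordinate inclusion of the block `{a, …, a + b - 1}`. -/
def blockIncl {m : ℕ} (a b : ℕ) (h : a + b ≤ m) : Matrix (Fin m) (Fin b) ℝ :=
  (1 : Matrix (Fin m) (Fin m) ℝ).submatrix id fun s : Fin b => ⟨a + s, by omega⟩

lemma blockIncl_transpose_mul_mul {m a b : ℕ} (h : a + b ≤ m) (H : Matrix (Fin m) (Fin m) ℝ) :
    (blockIncl a b h)ᵀ * H * blockIncl a b h =
      Matrix.of fun s t : Fin b => H ⟨a + s, by omega⟩ ⟨a + t, by omega⟩ := by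
  ext s t
  simp [blockIncl, mul_apply, one_apply]

lemma blockIncl_transpose_mul_self {m a b : ℕ} (h : a + b ≤ m) :
    (blockIncl a b h)ᵀ * blockIncl a b h = 1 := by
  have := blockIncl_transpose_mul_mul h 1
  rw [Matrix.mul_one] at this
  rw [this]
  ext s t
  simp [one_apply, Fin.ext_iff]

lemma blockIncl_mul_transpose {m a b : ℕ} (h : a + b ≤ m) :
    blockIncl a b h * (blockIncl a b h)ᵀ =
      diagonal fun i : Fin m => if a ≤ (i : ℕ) ∧ (i : ℕ) < a + b then 1 else 0 := by
  ext i j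
  simp only [blockIncl, mul_apply, submatrix_apply, transpose_apply, one_apply, id, diagonal_apply,
    Fin.ext_iff]
  by_cases hi : a ≤ (i : ℕ) ∧ (i : ℕ) < a + b
  · rw [Finset.sum_eq_single (⟨i - a, by omega⟩ : Fin b)]
    · have : a + ((i : ℕ) - a) = i := by omega
      simp [this, hi, eq_comm]
    · intro s _ hs
      have : (i : ℕ) ≠ a + s := fun h' => hs (Fin.ext (by simp; omega))
      simp [this]
    · simp
  · rw [if_neg hi, ite_self]
    refine Finset.sum_eq_zero fun s _ => ?_
    have : (i : ℕ) ≠ a + s := by omega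
    simp [this]

lemma eq_sunBlock {m a b c : ℕ} (habc : a + b + c = m) {lam : Fin m → ℝ}
    (hpos : ∀ i : Fin m, 0 < lam i ↔ (i : ℕ) < a)
    (hzero : ∀ i : Fin m, lam i = 0 ↔ (a ≤ (i : ℕ) ∧ (i : ℕ) < a + b))
    {Vb : Matrix (Fin b) (Fin b) ℝ →L[ℝ] Matrix (Fin b) (Fin b) ℝ}
    {N Ht : Matrix (Fin m) (Fin m) ℝ} (hN : Nᵀ = N) (hHt : Htᵀ = Ht)
    (hcomp : N * diagonal (fun i => max (-lam i) 0 + lam i) +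
      diagonal (fun i => max (-lam i) 0) * (N - Ht) = 0)
    (hblock : Matrix.of (fun s t : Fin b => N ⟨a + s, by omega⟩ ⟨a + t, by omega⟩) =
      Vb (Matrix.of fun s t : Fin b => Ht ⟨a + s, by omega⟩ ⟨a + t, by omega⟩)) :
    N = sunBlock a b c habc lam Vb Ht := by
  have hN' : ∀ i j, N i j = N j i := fun i j => by rw [← transpose_apply N, hN]
  have hH' : ∀ i j, Ht i j = Ht j i := fun i j => by rw [← transpose_apply Ht, hHt]
  have hc : ∀ i j, N i j * (max (-lam j) 0 + lam j) +
      max (-lam i) 0 * (N i j - Ht i j) = 0 := by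
    intro i j
    have := congrFun (congrFun hcomp i) j
    simpa only [Matrix.add_apply, mul_diagonal, diagonal_mul, Matrix.sub_apply,
      Matrix.zero_apply] using this
  have hneg : ∀ i : Fin m, a + b ≤ (i : ℕ) → lam i < 0 := by
    intro i hi
    rcases lt_trichotomy (lam i) 0 with h | h | h
    · exact h
    · have := (hzero i).1 h; omega
    · have := (hpos i).1 h; omega
  have hnp : ∀ i : Fin m, a ≤ (i : ℕ) → lam i ≤ 0 := fun i hi =>
    not_lt.1 fun h => by have := (hpos i).1 h; omega
  have hnn : ∀ i : Fin m, (i : ℕ) < a + b → 0 ≤ lam i := fun i hi =>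
    not_lt.1 fun h => by
      have h1 : ¬ 0 < lam i := h.not_gt
      rw [hpos] at h1
      exact h.ne ((hzero i).2 ⟨by omega, hi⟩)
  have hleft : ∀ i j : Fin m, (i : ℕ) < a + b → (j : ℕ) < a → N i j = 0 := by
    intro i j hi hj
    have h1 := hc i j
    have h2 := (hpos j).2 hj
    have h3 := hnn i hi
    rw [max_eq_right (by linarith), max_eq_right (by linarith)] at h1
    simpa [h2.ne'] using h1
  have hright : ∀ i j : Fin m, a + b ≤ (i : ℕ) → a ≤ (j : ℕ) → N i j = Ht i j := by
    intro i j hi hj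
    have h1 := hc i j
    have h2 := hneg i hi
    have h3 := hnp j hj
    rw [max_eq_left (by linarith), max_eq_left (by linarith), neg_add_cancel, mul_zero,
      zero_add] at h1
    rcases mul_eq_zero.1 h1 with h | h <;> linarith
  have hcorner : ∀ i j : Fin m, a + b ≤ (i : ℕ) → (j : ℕ) < a →
      N i j = Bcal (-lam j) (-lam i) * Ht i j := by
    intro i j hi hj
    have h1 := hc i j
    have h2 := hneg i hi
    have h3 := (hpos j).2 hj
    rw [max_eq_right (by linarith), max_eq_left (by linarith)] at h1
    have habs : |-lam j| + |-lam i| = lam j - lam i := by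
      rw [abs_neg, abs_neg, abs_of_pos h3, abs_of_neg h2]; ring
    have hne : lam j - lam i ≠ 0 := by linarith
    rw [Bcal, habs, if_neg hne, max_eq_right (by linarith : -lam j ≤ 0),
      max_eq_left (by linarith : 0 ≤ -lam i), div_mul_eq_mul_div, eq_div_iff hne]
    linarith
  ext i j
  simp only [sunBlock, Matrix.of_apply]
  by_cases hia : (i : ℕ) < a
  · rw [if_pos hia]
    split_ifs with hj
    · rw [hN', hleft j i hj hia]
    · rw [hN', hcorner j i (by omega) hia, hH']
  · rw [if_neg hia]
    by_cases hib : (i : ℕ) < a + b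
    · rw [dif_pos hib]
      by_cases hja : (j : ℕ) < a
      · rw [dif_pos hja, hleft i j hib hja]
      · rw [dif_neg hja]
        by_cases hjb : (j : ℕ) < a + b
        · rw [dif_pos hjb, ← hblock, Matrix.of_apply]
          congr 1 <;> exact Fin.ext (by simp; omega)
        · rw [dif_neg hjb, hN', hright j i (by omega) (by omega), hH']
    · rw [dif_neg hib]
      split_ifs with hja hjb
      · rw [hcorner i j (by omega) hja, hH']
      · rw [hright i j (by omega) (by omega), hH']
      · exact hright i j (by omega) (by omega)

lemma sunBlock_convexComb {m a b c : ℕ} (habc : a + b + c = m) (lam : Fin m → ℝ)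
    (Vb Wb : Matrix (Fin b) (Fin b) ℝ →L[ℝ] Matrix (Fin b) (Fin b) ℝ)
    (Ht : Matrix (Fin m) (Fin m) ℝ) {x y : ℝ} (hxy : x + y = 1) :
    sunBlock a b c habc lam (x • Vb + y • Wb) Ht =
      x • sunBlock a b c habc lam Vb Ht + y • sunBlock a b c habc lam Wb Ht := by
  have hy : y = 1 - x := by linarith
  subst hy
  ext i j
  simp only [sunBlock, Matrix.of_apply, Matrix.add_apply, Matrix.smul_apply, smul_eq_mul]
  split_ifs <;> first
    | ring1
    | rfl

lemma apply_eq_sunBlock {m a b c : ℕ} (habc : a + b + c = m) (hab : a + b ≤ m)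
    {M U : Matrix (Fin m) (Fin m) ℝ} {lam : Fin m → ℝ}
    (hU : Uᵀ * U = 1) (hdec : M = U * diagonal lam * Uᵀ)
    (hpos : ∀ i : Fin m, 0 < lam i ↔ (i : ℕ) < a)
    (hzero : ∀ i : Fin m, lam i = 0 ↔ (a ≤ (i : ℕ) ∧ (i : ℕ) < a + b))
    {V : Matrix (Fin m) (Fin m) ℝ →L[ℝ] Matrix (Fin m) (Fin m) ℝ}
    {Vb : Matrix (Fin b) (Fin b) ℝ →L[ℝ] Matrix (Fin b) (Fin b) ℝ}
    (hV : ∀ H, (V H)ᵀ = V H ∧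
      V H * (psdProjMap (-M) - symPart (-M)) + psdProjMap (-M) * (V H - symPart H) = 0)
    (hVb : ∀ H, (blockIncl a b hab)ᵀ * (Uᵀ * V (U * H * Uᵀ) * U) * blockIncl a b hab =
      Vb ((blockIncl a b hab)ᵀ * H * blockIncl a b hab))
    {H : Matrix (Fin m) (Fin m) ℝ} (hH : H.IsHermitian) :
    V H = U * sunBlock a b c habc lam Vb (Uᵀ * H * U) * Uᵀ := by
  have hU' : U * Uᵀ = 1 := mul_eq_one_comm.1 hU
  have hHt : Hᵀ = H := by rw [← conjTranspose_eq_transpose_of_trivial]; exact hH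
  have hUU : ∀ X, U * (Uᵀ * X * U) * Uᵀ = X := fun X => by
    calc _ = (U * Uᵀ) * X * (U * Uᵀ) := by simp only [Matrix.mul_assoc]
      _ = X := by simp [hU']
  have hneg : -M = U * diagonal (fun i => -lam i) * Uᵀ := by
    have : diagonal (fun i => -lam i) = -diagonal lam := by rw [diagonal_neg]
    rw [hdec, this, Matrix.mul_neg, Matrix.neg_mul]
  have hsym : symPart (-M) = -M := symPart_of_transpose_eq (by
    rw [hneg, transpose_mul, transpose_mul, diagonal_transpose, transpose_transpose,
      Matrix.mul_assoc])
  have hproj : psdProjMap (-M) = U * diagonal (fun i => max (-lam i) 0) * Uᵀ := by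
    rw [hneg, psdProjMap_conj hU, psdProjMap_diagonal]
  have hdiff : psdProjMap (-M) - symPart (-M) =
      U * diagonal (fun i => max (-lam i) 0 + lam i) * Uᵀ := by
    rw [hsym, hproj, hneg, ← Matrix.sub_mul, ← Matrix.mul_sub, diagonal_sub]
    simp
  obtain ⟨hVt, hcomp⟩ := hV H
  rw [hdiff, hproj, symPart_of_transpose_eq hHt] at hcomp
  have key := eq_sunBlock (Vb := Vb) habc hpos hzero
    (N := Uᵀ * V H * U) (Ht := Uᵀ * H * U)
    (by rw [transpose_mul, transpose_mul, transpose_transpose, hVt, Matrix.mul_assoc])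
    (by rw [transpose_mul, transpose_mul, transpose_transpose, hHt, Matrix.mul_assoc])
    (by
      have h1 := congrArg (fun X => Uᵀ * X * U) hcomp
      simp only [Matrix.mul_zero, Matrix.zero_mul] at h1
      rw [← h1, Matrix.mul_add, Matrix.add_mul]
      congr 1
      · calc _ = Uᵀ * V H * U * diagonal (fun i => max (-lam i) 0 + lam i) * (Uᵀ * U) := by
              rw [hU, Matrix.mul_one]
          _ = _ := by simp only [Matrix.mul_assoc]
      · calc _ = (Uᵀ * U) * diagonal (fun i => max (-lam i) 0) *
                (Uᵀ * V H * U - Uᵀ * H * U) := by rw [hU, Matrix.one_mul]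
          _ = _ := by rw [← Matrix.sub_mul, ← Matrix.mul_sub]; simp only [Matrix.mul_assoc])
    (by
      have h1 := hVb (Uᵀ * H * U)
      rw [hUU, blockIncl_transpose_mul_mul, blockIncl_transpose_mul_mul] at h1
      exact h1)
  rw [← key, hUU]

lemma LipschitzWith.exists_subseq_tendsto_fderiv {E F : Type*} [NormedAddCommGroup E]
    [NormedSpace ℝ E] [FiniteDimensional ℝ E] [NormedAddCommGroup F] [NormedSpace ℝ F]
    [FiniteDimensional ℝ F] {f : E → F} {K : NNReal} (hf : LipschitzWith K f) (u : ℕ → E) :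
    ∃ (V : E →L[ℝ] F) (φ : ℕ → ℕ), StrictMono φ ∧
      Tendsto (fun k => fderiv ℝ f (u (φ k))) atTop (𝓝 V) := by
  have : ProperSpace (E →L[ℝ] F) := FiniteDimensional.proper ℝ _
  obtain ⟨V, -, φ, hφ, hV⟩ := tendsto_subseq_of_bounded
    (x := fun k => fderiv ℝ f (u k)) (Metric.isBounded_closedBall (x := 0) (r := (K : ℝ)))
    fun k => mem_closedBall_zero_iff.2 (norm_fderiv_le_of_lipschitz ℝ hf)
  exact ⟨V, φ, hφ, hV⟩

/-- The characterizing identity is preserved by convex combinations. -/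
lemma convexComb_eq_sunBlock {m a b c : ℕ} (habc : a + b + c = m)
    {U : Matrix (Fin m) (Fin m) ℝ} {lam : Fin m → ℝ}
    {V W : Matrix (Fin m) (Fin m) ℝ →L[ℝ] Matrix (Fin m) (Fin m) ℝ}
    {Vb Wb : Matrix (Fin b) (Fin b) ℝ →L[ℝ] Matrix (Fin b) (Fin b) ℝ}
    {H : Matrix (Fin m) (Fin m) ℝ}
    (hV : V H = U * sunBlock a b c habc lam Vb (Uᵀ * H * U) * Uᵀ)
    (hW : W H = U * sunBlock a b c habc lam Wb (Uᵀ * H * U) * Uᵀ)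
    {x y : ℝ} (hxy : x + y = 1) :
    (x • V + y • W) H = U * sunBlock a b c habc lam (x • Vb + y • Wb) (Uᵀ * H * U) * Uᵀ := by
  have h : (x • V + y • W) H = x • V H + y • W H := rfl
  rw [h, sunBlock_convexComb habc lam Vb Wb _ hxy, hV, hW, Matrix.mul_add, Matrix.add_mul,
    Matrix.mul_smul, Matrix.mul_smul, Matrix.smul_mul, Matrix.smul_mul]

lemma continuous_symPart {m : ℕ} :
    Continuous (symPart : Matrix (Fin m) (Fin m) ℝ → Matrix (Fin m) (Fin m) ℝ) := by
  unfold symPart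
  fun_prop

lemma symPart_symPart {m : ℕ} (X : Matrix (Fin m) (Fin m) ℝ) : symPart (symPart X) = symPart X :=
  symPart_of_transpose_eq (transpose_symPart X)

lemma fderiv_psdProjMap_symPart {m : ℕ} {X : Matrix (Fin m) (Fin m) ℝ}
    (h : DifferentiableAt ℝ psdProjMap X) :
    DifferentiableAt ℝ psdProjMap (symPart X) ∧
      fderiv ℝ psdProjMap (symPart X) = fderiv ℝ psdProjMap X := by
  have h' := h.hasFDerivAt.psdProjMap_of_symPart_eq (symPart_symPart X).symm
  exact ⟨h'.differentiableAt, h'.fderiv⟩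

/-- Every limiting derivative is attained along symmetric matrices. -/
lemma exists_symmetric_seq {m : ℕ} {x : Matrix (Fin m) (Fin m) ℝ} (hx : xᵀ = x)
    {V : Matrix (Fin m) (Fin m) ℝ →L[ℝ] Matrix (Fin m) (Fin m) ℝ}
    {u : ℕ → Matrix (Fin m) (Fin m) ℝ} (hu : ∀ k, DifferentiableAt ℝ psdProjMap (u k))
    (hux : Tendsto u atTop (𝓝 x))
    (hV : Tendsto (fun k => fderiv ℝ psdProjMap (u k)) atTop (𝓝 V)) :
    ∃ s : ℕ → Matrix (Fin m) (Fin m) ℝ, (∀ k, (s k)ᵀ = s k) ∧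
      (∀ k, DifferentiableAt ℝ psdProjMap (s k)) ∧ Tendsto s atTop (𝓝 x) ∧
      Tendsto (fun k => fderiv ℝ psdProjMap (s k)) atTop (𝓝 V) := by
  refine ⟨fun k => symPart (u k), fun k => transpose_symPart _,
    fun k => (fderiv_psdProjMap_symPart (hu k)).1, ?_, ?_⟩
  · have := (continuous_symPart.tendsto x).comp hux
    rwa [symPart_of_transpose_eq hx] at this
  · simpa only [fun k => (fderiv_psdProjMap_symPart (hu k)).2] using hV

/-- A convergent sequence of symmetric matrices has, along a subsequence, the form
`Q k * A k * (Q k)ᵀ` where `Q k` is orthogonal and tends to a prescribed eigenbasis of the limit,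
and `A k` commutes with the spectral projection of the limit onto its kernel. -/
lemma exists_subseq_conj {m : ℕ} {U : Matrix (Fin m) (Fin m) ℝ} {μ : Fin m → ℝ}
    (hU : Uᵀ * U = 1) {s : ℕ → Matrix (Fin m) (Fin m) ℝ} (hs : ∀ k, (s k)ᵀ = s k)
    (hsx : Tendsto s atTop (𝓝 (U * diagonal μ * Uᵀ))) :
    ∃ (φ : ℕ → ℕ) (Q A : ℕ → Matrix (Fin m) (Fin m) ℝ), StrictMono φ ∧
      (∀ k, (Q k)ᵀ * Q k = 1) ∧ Tendsto Q atTop (𝓝 U) ∧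
      (∀ k, diagonal (fun i => if μ i = 0 then (1 : ℝ) else 0) * A k =
        A k * diagonal (fun i => if μ i = 0 then (1 : ℝ) else 0)) ∧
      ∀ k, s (φ k) = Q k * A k * (Q k)ᵀ := by
  have hdec : ∀ k, ∃ (Q : Matrix (Fin m) (Fin m) ℝ) (d : Fin m → ℝ),
      Qᵀ * Q = 1 ∧ s k = Q * diagonal d * Qᵀ := fun k =>
    IsHermitian.exists_orthogonal_diagonal (by
      rw [Matrix.IsHermitian, conjTranspose_eq_transpose_of_trivial]; exact hs k)
  choose Q d hQ hsQ using hdec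
  have : FirstCountableTopology (Matrix (Fin m) (Fin m) ℝ) :=
    inferInstanceAs (FirstCountableTopology (Fin m → Fin m → ℝ))
  obtain ⟨R, hR, φ, hφ, hQR⟩ := (isCompact_setOf_transpose_mul_self m).tendsto_subseq
    (x := Q) hQ
  replace hR : Rᵀ * R = 1 := hR
  have hU' : U * Uᵀ = 1 := mul_eq_one_comm.1 hU
  have hR' : R * Rᵀ = 1 := mul_eq_one_comm.1 hR
  have hD : Tendsto (fun k => diagonal (d (φ k))) atTop
      (𝓝 (Rᵀ * (U * diagonal μ * Uᵀ) * R)) := by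
    have hc : Continuous fun p : Matrix (Fin m) (Fin m) ℝ × Matrix (Fin m) (Fin m) ℝ =>
        p.1ᵀ * p.2 * p.1 := by fun_prop
    have h := (hc.tendsto (R, U * diagonal μ * Uᵀ)).comp
      (hQR.prodMk_nhds (hsx.comp hφ.tendsto_atTop))
    refine h.congr fun k => ?_
    change (Q (φ k))ᵀ * s (φ k) * Q (φ k) = _
    rw [hsQ]
    calc _ = ((Q (φ k))ᵀ * Q (φ k)) * diagonal (d (φ k)) * ((Q (φ k))ᵀ * Q (φ k)) := by
          simp only [Matrix.mul_assoc]
      _ = _ := by rw [hQ, Matrix.one_mul, Matrix.mul_one]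
  obtain ⟨δ, hδ⟩ : ∃ δ : Fin m → ℝ, Rᵀ * (U * diagonal μ * Uᵀ) * R = diagonal δ := by
    refine ⟨fun i => (Rᵀ * (U * diagonal μ * Uᵀ) * R) i i, ?_⟩
    ext i j
    by_cases hij : i = j
    · subst hij; simp
    · rw [diagonal_apply_ne _ hij]
      have hc : Continuous fun X : Matrix (Fin m) (Fin m) ℝ => X i j := by fun_prop
      have h := (hc.tendsto _).comp hD
      refine tendsto_nhds_unique h (tendsto_const_nhds.congr fun k => ?_)
      simp [diagonal_apply_ne _ hij]
  obtain ⟨W, hWdef⟩ : ∃ W, W = Uᵀ * R := ⟨_, rfl⟩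
  have hW : Wᵀ * W = 1 := by
    rw [hWdef, transpose_mul, transpose_transpose]
    calc _ = Rᵀ * (U * Uᵀ) * R := by simp only [Matrix.mul_assoc]
      _ = 1 := by rw [hU', Matrix.mul_one, hR]
  have hWδ : W * diagonal δ = diagonal μ * W := by
    rw [← hδ, hWdef]
    calc _ = Uᵀ * (R * Rᵀ) * U * diagonal μ * Uᵀ * R := by simp only [Matrix.mul_assoc]
      _ = _ := by rw [hR', Matrix.mul_one, hU, Matrix.one_mul, Matrix.mul_assoc]
  have hPW : diagonal (fun i => if μ i = 0 then (1 : ℝ) else 0) * W =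
      W * diagonal (fun i => if δ i = 0 then (1 : ℝ) else 0) := by
    ext i j
    have h := congrFun (congrFun hWδ i) j
    rw [mul_diagonal, diagonal_mul] at h ⊢
    by_cases hw : W i j = 0
    · simp [hw]
    · have : δ j = μ i := mul_left_cancel₀ hw (by rw [h, mul_comm])
      rw [this, mul_comm]
  have hWP : Wᵀ * diagonal (fun i => if μ i = 0 then (1 : ℝ) else 0) =
      diagonal (fun i => if δ i = 0 then (1 : ℝ) else 0) * Wᵀ := by
    simpa only [transpose_mul, diagonal_transpose] using congrArg transpose hPW
  refine ⟨φ, fun k => Q (φ k) * Wᵀ, fun k => W * diagonal (d (φ k)) * Wᵀ, hφ, fun k => ?_, ?_,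
    fun k => ?_, fun k => ?_⟩
  · rw [transpose_mul, transpose_transpose]
    calc _ = W * ((Q (φ k))ᵀ * Q (φ k)) * Wᵀ := by simp only [Matrix.mul_assoc]
      _ = 1 := by rw [hQ, Matrix.mul_one, mul_eq_one_comm.1 hW]
  · have hc : Continuous fun X : Matrix (Fin m) (Fin m) ℝ => X * Wᵀ := by fun_prop
    have h := (hc.tendsto R).comp hQR
    have hRW : R * Wᵀ = U := by
      rw [hWdef, transpose_mul, transpose_transpose, ← Matrix.mul_assoc, hR', Matrix.one_mul]
    rwa [hRW] at h
  · rw [← Matrix.mul_assoc, ← Matrix.mul_assoc, hPW, Matrix.mul_assoc (W * _) Wᵀ, hWP,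
      ← Matrix.mul_assoc, Matrix.mul_assoc W, Matrix.mul_assoc W (diagonal (d (φ k))),
      diagonal_mul_diagonal, diagonal_mul_diagonal]
    simp only [mul_comm]
  · rw [hsQ, transpose_mul, transpose_transpose]
    calc _ = Q (φ k) * 1 * diagonal (d (φ k)) * 1 * (Q (φ k))ᵀ := by simp
      _ = Q (φ k) * (Wᵀ * W) * diagonal (d (φ k)) * (Wᵀ * W) * (Q (φ k))ᵀ := by rw [hW]
      _ = _ := by simp only [Matrix.mul_assoc]

lemma blockIncl_mul_transpose_eq {m a b : ℕ} (hab : a + b ≤ m) {lam : Fin m → ℝ}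
    (hzero : ∀ i : Fin m, lam i = 0 ↔ (a ≤ (i : ℕ) ∧ (i : ℕ) < a + b)) :
    blockIncl a b hab * (blockIncl a b hab)ᵀ =
      diagonal fun i => if -lam i = 0 then (1 : ℝ) else 0 := by
  rw [blockIncl_mul_transpose]
  simp only [neg_eq_zero, hzero]

lemma blockIncl_transpose_mul_diagonal_neg {m a b : ℕ} (hab : a + b ≤ m) {lam : Fin m → ℝ}
    (hzero : ∀ i : Fin m, lam i = 0 ↔ (a ≤ (i : ℕ) ∧ (i : ℕ) < a + b)) :
    (blockIncl a b hab)ᵀ * diagonal (fun i => -lam i) = 0 := by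
  ext s j
  rw [mul_diagonal, transpose_apply, Matrix.zero_apply]
  simp only [blockIncl, submatrix_apply, id, one_apply]
  split_ifs with h
  · rw [(hzero j).2 (by subst h; simp), neg_zero, mul_zero]
  · rw [zero_mul]

lemma exists_block_of_limit {m a b c : ℕ} (habc : a + b + c = m)
    {M U : Matrix (Fin m) (Fin m) ℝ} {lam : Fin m → ℝ}
    (hM : Mᵀ = M) (hU : Uᵀ * U = 1) (hdec : M = U * diagonal lam * Uᵀ)
    (hpos : ∀ i : Fin m, 0 < lam i ↔ (i : ℕ) < a)
    (hzero : ∀ i : Fin m, lam i = 0 ↔ (a ≤ (i : ℕ) ∧ (i : ℕ) < a + b))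
    {V : Matrix (Fin m) (Fin m) ℝ →L[ℝ] Matrix (Fin m) (Fin m) ℝ}
    {u : ℕ → Matrix (Fin m) (Fin m) ℝ} (hu : ∀ k, DifferentiableAt ℝ psdProjMap (u k))
    (hux : Tendsto u atTop (𝓝 (-M)))
    (hV : Tendsto (fun k => fderiv ℝ psdProjMap (u k)) atTop (𝓝 V)) :
    ∃ Vb ∈ clarkeSubdiff (psdProjMap (m := b)) 0,
      ∀ H : Matrix (Fin m) (Fin m) ℝ, H.IsHermitian →
        V H = U * sunBlock a b c habc lam Vb (Uᵀ * H * U) * Uᵀ := by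
  have hab : a + b ≤ m := by omega
  have hneg : -M = U * diagonal (fun i => -lam i) * Uᵀ := by
    have : diagonal (fun i => -lam i) = -diagonal lam := by rw [diagonal_neg]
    rw [hdec, this, Matrix.mul_neg, Matrix.neg_mul]
  obtain ⟨s, hs, hsd, hsx, hsV⟩ :=
    exists_symmetric_seq (by rw [transpose_neg, hM]) hu hux hV
  obtain ⟨φ, Q, A, hφ, hQ, hQU, hA, hsQ⟩ := exists_subseq_conj hU hs (hneg ▸ hsx)
  rw [← blockIncl_mul_transpose_eq hab hzero] at hA
  have hsφ : Tendsto (fun k => fderiv ℝ psdProjMap (Q k * A k * (Q k)ᵀ)) atTop (𝓝 V) := by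
    simpa only [Function.comp_def, hsQ] using hsV.comp hφ.tendsto_atTop
  obtain ⟨Vb, hd, ht, hVb⟩ := tendsto_fderiv_psdProjMap_compress
    (blockIncl_transpose_mul_self hab) hQ hQU hA (fun k => hsQ k ▸ hsd (φ k)) hsφ
  refine ⟨Vb, subset_convexHull ℝ _ ⟨_, hd, ?_, ht⟩, fun H hH =>
    apply_eq_sunBlock habc hab hU hdec hpos hzero
      (tendsto_fderiv_psdProjMap_complementarity hu hux hV) hVb hH⟩
  have hc : Continuous fun p : Matrix (Fin m) (Fin m) ℝ × Matrix (Fin m) (Fin m) ℝ =>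
      (blockIncl a b hab)ᵀ * (p.1ᵀ * p.2 * p.1) * blockIncl a b hab := by fun_prop
  have h := (hc.tendsto (U, -M)).comp (hQU.prodMk_nhds (hsx.comp hφ.tendsto_atTop))
  have hlim : (blockIncl a b hab)ᵀ * (Uᵀ * -M * U) * blockIncl a b hab = 0 := by
    have : Uᵀ * -M * U = diagonal fun i => -lam i := by
      rw [hneg]
      calc _ = (Uᵀ * U) * diagonal (fun i => -lam i) * (Uᵀ * U) := by
            simp only [Matrix.mul_assoc]
        _ = _ := by rw [hU, Matrix.one_mul, Matrix.mul_one]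
    rw [this, blockIncl_transpose_mul_diagonal_neg hab hzero, Matrix.zero_mul]
  change Tendsto _ _ (𝓝 ((blockIncl a b hab)ᵀ * (Uᵀ * -M * U) * blockIncl a b hab)) at h
  rw [hlim] at h
  refine h.congr fun k => ?_
  change (blockIncl a b hab)ᵀ * ((Q k)ᵀ * s (φ k) * Q k) * blockIncl a b hab = _
  have : (Q k)ᵀ * s (φ k) * Q k = A k := by
    rw [hsQ]
    calc _ = ((Q k)ᵀ * Q k) * A k * ((Q k)ᵀ * Q k) := by simp only [Matrix.mul_assoc]
      _ = _ := by rw [hQ, Matrix.one_mul, Matrix.mul_one]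
  rw [this]

lemma exists_limit_of_block {m a b c : ℕ} (habc : a + b + c = m)
    {M U : Matrix (Fin m) (Fin m) ℝ} {lam : Fin m → ℝ}
    (hU : Uᵀ * U = 1) (hdec : M = U * diagonal lam * Uᵀ)
    (hpos : ∀ i : Fin m, 0 < lam i ↔ (i : ℕ) < a)
    (hzero : ∀ i : Fin m, lam i = 0 ↔ (a ≤ (i : ℕ) ∧ (i : ℕ) < a + b))
    {Vb : Matrix (Fin b) (Fin b) ℝ →L[ℝ] Matrix (Fin b) (Fin b) ℝ}
    {u : ℕ → Matrix (Fin b) (Fin b) ℝ} (hu : ∀ k, DifferentiableAt ℝ psdProjMap (u k))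
    (hux : Tendsto u atTop (𝓝 0))
    (hVb : Tendsto (fun k => fderiv ℝ psdProjMap (u k)) atTop (𝓝 Vb)) :
    ∃ V ∈ clarkeSubdiff (psdProjMap (m := m)) (-M),
      ∀ H : Matrix (Fin m) (Fin m) ℝ, H.IsHermitian →
        V H = U * sunBlock a b c habc lam Vb (Uᵀ * H * U) * Uᵀ := by
  have hab : a + b ≤ m := by omega
  have hneg : -M = U * diagonal (fun i => -lam i) * Uᵀ := by
    have : diagonal (fun i => -lam i) = -diagonal lam := by rw [diagonal_neg]
    rw [hdec, this, Matrix.mul_neg, Matrix.neg_mul]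
  obtain ⟨Y, hY, hYd, hY0, hYV⟩ := exists_symmetric_seq transpose_zero hu hux hVb
  have hEE := blockIncl_transpose_mul_self hab
  have hED := blockIncl_transpose_mul_diagonal_neg hab hzero
  have hDE : diagonal (fun i => -lam i) * blockIncl a b hab = 0 := by
    simpa only [transpose_mul, diagonal_transpose, transpose_transpose, transpose_zero] using
      congrArg transpose hED
  have hP := blockIncl_mul_transpose_eq hab hzero
  set E := blockIncl a b hab
  set D : Matrix (Fin m) (Fin m) ℝ := diagonal fun i => -lam i with hD
  set A : ℕ → Matrix (Fin m) (Fin m) ℝ := fun k => D + E * Y k * Eᵀ with hAdef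
  have hEA : ∀ k, Eᵀ * A k = Y k * Eᵀ := fun k => by
    rw [hAdef]
    simp only [Matrix.mul_add, hED, zero_add, ← Matrix.mul_assoc, hEE, Matrix.one_mul]
  have hAE : ∀ k, A k * E = E * Y k := fun k => by
    rw [hAdef]
    simp only [Matrix.add_mul, hDE, zero_add, Matrix.mul_assoc, hEE, Matrix.mul_one]
  have hAsymm : ∀ k, (A k)ᵀ = A k := fun k => by
    simp only [hAdef, hD, transpose_add, transpose_mul, diagonal_transpose, transpose_transpose,
      hY, Matrix.mul_assoc]
  have hAinj : ∀ k v, A k *ᵥ v = 0 → v = 0 := by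
    intro k v hv
    have h1 : Eᵀ *ᵥ v = 0 := by
      refine eq_zero_of_mulVec_of_differentiableAt_psdProjMap (hY k) (hYd k) ?_
      rw [mulVec_mulVec, ← hEA, ← mulVec_mulVec, hv, mulVec_zero]
    have h2 : D *ᵥ v = 0 := by
      have h3 : A k *ᵥ v = D *ᵥ v + (E * Y k) *ᵥ (Eᵀ *ᵥ v) := by
        rw [mulVec_mulVec, ← add_mulVec]
      rw [hv, h1, mulVec_zero, add_zero] at h3
      exact h3.symm
    have h4 : (E * Eᵀ) *ᵥ v = 0 := by rw [← mulVec_mulVec, h1, mulVec_zero]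
    rw [hP] at h4
    ext i
    have h5 := congrFun h2 i
    have h6 := congrFun h4 i
    rw [hD, mulVec_diagonal] at h5
    rw [mulVec_diagonal] at h6
    by_cases hi : -lam i = 0
    · simpa [hi] using h6
    · exact (mul_eq_zero.1 h5).resolve_left hi
  have hX : ∀ k, DifferentiableAt ℝ psdProjMap (U * A k * Uᵀ) := fun k =>
    ((differentiableAt_psdProjMap_of_mulVec (hAsymm k) (hAinj k)).hasFDerivAt.psdProjMap_conj
      hU).differentiableAt
  have hXlim : Tendsto (fun k => U * A k * Uᵀ) atTop (𝓝 (-M)) := by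
    have hc : Continuous fun Z : Matrix (Fin b) (Fin b) ℝ => U * (D + E * Z * Eᵀ) * Uᵀ := by
      fun_prop
    have h := (hc.tendsto 0).comp hY0
    simp only [Matrix.mul_zero, Matrix.zero_mul, add_zero, ← hneg] at h
    exact h
  obtain ⟨V, φ, hφ, hV⟩ := (lipschitzWith_psdProjMap m).exists_subseq_tendsto_fderiv
    fun k => U * A k * Uᵀ
  have hXφ := hXlim.comp hφ.tendsto_atTop
  obtain ⟨Vb', -, ht, hVb'⟩ := tendsto_fderiv_psdProjMap_compress hEE
    (Q := fun _ => U) (fun _ => hU) tendsto_const_nhds (A := fun k => A (φ k))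
    (fun k => by rw [Matrix.mul_assoc, hEA, ← Matrix.mul_assoc (A _), hAE, Matrix.mul_assoc])
    (fun k => hX (φ k)) hV
  have hVV : Vb' = Vb := by
    refine tendsto_nhds_unique ht ?_
    have := hYV.comp hφ.tendsto_atTop
    refine this.congr fun k => ?_
    rw [hEA, Matrix.mul_assoc, hEE, Matrix.mul_one]
    rfl
  subst hVV
  exact ⟨V, subset_convexHull ℝ _ ⟨_, fun k => hX (φ k), hXφ, hV⟩, fun H hH =>
    apply_eq_sunBlock habc hab hU hdec hpos hzero
      (tendsto_fderiv_psdProjMap_complementarity (fun k => hX (φ k)) hXφ hV) hVb' hH⟩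

/-- Sun's characterization of the Clarke subdifferential of the PSD
projection. -/
theorem stmt2 {m b : ℕ} (a c : ℕ) (habc : a + b + c = m)
    (M U : Matrix (Fin m) (Fin m) ℝ) (lam : Fin m → ℝ)
    (hM : M.IsHermitian) (hU : Uᵀ * U = 1) (hdec : M = U * Matrix.diagonal lam * Uᵀ)
    (hmono : ∀ i j : Fin m, i ≤ j → lam j ≤ lam i)
    (hpos : ∀ i : Fin m, 0 < lam i ↔ (i : ℕ) < a)
    (hzero : ∀ i : Fin m, lam i = 0 ↔ (a ≤ (i : ℕ) ∧ (i : ℕ) < a + b)) :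
    (∀ V ∈ clarkeSubdiff (psdProjMap (m := m)) (-M),
      ∃ Vb ∈ clarkeSubdiff (psdProjMap (m := b)) 0,
        ∀ H : Matrix (Fin m) (Fin m) ℝ, H.IsHermitian →
          V H = U * sunBlock a b c habc lam Vb (Uᵀ * H * U) * Uᵀ) ∧
    (∀ Vb ∈ clarkeSubdiff (psdProjMap (m := b)) 0,
      ∃ V ∈ clarkeSubdiff (psdProjMap (m := m)) (-M),
        ∀ H : Matrix (Fin m) (Fin m) ℝ, H.IsHermitian →
          V H = U * sunBlock a b c habc lam Vb (Uᵀ * H * U) * Uᵀ) := by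
  have hMt : Mᵀ = M := by rw [← conjTranspose_eq_transpose_of_trivial]; exact hM
  refine ⟨fun V hV => ?_, fun Vb hVb => ?_⟩
  · refine convexHull_min (t := {V | ∃ Vb ∈ clarkeSubdiff (psdProjMap (m := b)) 0,
      ∀ H : Matrix (Fin m) (Fin m) ℝ, H.IsHermitian →
        V H = U * sunBlock a b c habc lam Vb (Uᵀ * H * U) * Uᵀ}) ?_ ?_ hV
    · rintro V ⟨u, hu, hux, hV⟩
      exact exists_block_of_limit habc hMt hU hdec hpos hzero hu hux hV
    · rintro V ⟨Vb, hVb, hV⟩ W ⟨Wb, hWb, hW⟩ x y hx hy hxy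
      exact ⟨x • Vb + y • Wb, convex_convexHull ℝ _ hVb hWb hx hy hxy, fun H hH =>
        convexComb_eq_sunBlock habc (hV H hH) (hW H hH) hxy⟩
  · refine convexHull_min (t := {Vb | ∃ V ∈ clarkeSubdiff (psdProjMap (m := m)) (-M),
      ∀ H : Matrix (Fin m) (Fin m) ℝ, H.IsHermitian →
        V H = U * sunBlock a b c habc lam Vb (Uᵀ * H * U) * Uᵀ}) ?_ ?_ hVb
    · rintro Vb ⟨u, hu, hux, hVb⟩
      exact exists_limit_of_block habc hU hdec hpos hzero hu hux hVb
    · rintro Vb ⟨V, hV, hVe⟩ Wb ⟨W, hW, hWe⟩ x y hx hy hxy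
      exact ⟨x • V + y • W, convex_convexHull ℝ _ hV hW hx hy hxy, fun H hH =>
        convexComb_eq_sunBlock habc (hVe H hH) (hWe H hH) hxy⟩

end
end

section
/- Let x̄ be an AKKT point of the NSDP at which Robinson's constraint qualification holds, and let (xᵏ, μᵏ, Ωₖ) be an AKKT sequence corresponding to x̄. Then there exist μ̄ ∈ ℝᵖ, Ω̄ ∈ Sᵐ₊, and a subsequence indexed by kⱼ such that μ^{kⱼ} → μ̄ and Ω_{kⱼ} → Ω̄ as j → ∞, and (x̄, μ̄, Ω̄) satisfies the KKT conditions. -/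
open Matrix Filter Topology Set

attribute [local instance] Matrix.normedAddCommGroup Matrix.normedSpace

noncomputable section

/-- The trace pairing of a positive definite matrix with a nonzero positive semidefinite matrix
does not vanish. -/
lemma Matrix.PosSemidef.eq_zero_of_finner_posDef_eq_zero {m : ℕ}
    {A W : Matrix (Fin m) (Fin m) ℝ} (hA : A.PosDef) (hW : W.PosSemidef)
    (h0 : finner A W = 0) : W = 0 := by
  obtain ⟨B, rfl⟩ : ∃ B : Matrix (Fin m) (Fin m) ℝ, W = Bᴴ * B := by
    open scoped MatrixOrder in
    exact CStarAlgebra.nonneg_iff_eq_star_mul_self.mp hW.nonneg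
  have hAt : Aᵀ = A := by simpa using hA.isHermitian.eq
  have hz : B * A * Bᴴ = 0 := by
    rw [← (hA.posSemidef.mul_mul_conjTranspose_same B).trace_eq_zero_iff, Matrix.mul_assoc,
      Matrix.trace_mul_comm, Matrix.mul_assoc, ← h0, finner, hAt]
  have hB : B = 0 := by
    ext i j
    by_contra hne
    have hrow : star (B i) ≠ 0 := fun hc => hne (by simpa using congrFun hc j)
    have hpos := hA.dotProduct_mulVec_pos hrow
    have hii := congrFun (congrFun hz i) i
    rw [Matrix.mul_assoc] at hii
    simp [Matrix.mul_apply, dotProduct, Matrix.mulVec] at hii hpos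
    linarith
  simp [hB]

lemma finner_continuous {m : ℕ} :
    Continuous fun q : Matrix (Fin m) (Fin m) ℝ × Matrix (Fin m) (Fin m) ℝ => finner q.1 q.2 := by
  unfold finner
  fun_prop

lemma finner_smul_right {m : ℕ} (c : ℝ) (A B : Matrix (Fin m) (Fin m) ℝ) :
    finner A (c • B) = c * finner A B := by
  simp [finner]

lemma finner_add_left {m : ℕ} (A B C : Matrix (Fin m) (Fin m) ℝ) :
    finner (A + B) C = finner A C + finner B C := by
  simp [finner, Matrix.add_mul]

/-- The linear functional `⟨·, B⟩` as a continuous linear map. -/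
def finnerCLM {m : ℕ} (B : Matrix (Fin m) (Fin m) ℝ) : Matrix (Fin m) (Fin m) ℝ →L[ℝ] ℝ :=
  LinearMap.toContinuousLinearMap
    { toFun := fun A => finner A B
      map_add' := fun A C => finner_add_left A C B
      map_smul' := fun c A => by simp [finner] }

@[simp]
lemma finnerCLM_apply {m : ℕ} (A B : Matrix (Fin m) (Fin m) ℝ) : finnerCLM B A = finner A B := rfl

/-- The set of positive semidefinite matrices is closed. -/
lemma isClosed_setOf_posSemidef {m : ℕ} :
    IsClosed {A : Matrix (Fin m) (Fin m) ℝ | A.PosSemidef} := by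
  simp only [Matrix.posSemidef_iff_dotProduct_mulVec, Set.ofPred_and, Set.ofPred_forall]
  refine IsClosed.inter ?_ (isClosed_iInter fun v => ?_)
  · exact isClosed_eq (by fun_prop) continuous_id
  · exact isClosed_le continuous_const (by fun_prop)

/-- The directional form of the gradient of the Lagrangian. -/
lemma sum_gradLag_mul {n p m : ℕ} {f : (Fin n → ℝ) → ℝ} {h : (Fin n → ℝ) → (Fin p → ℝ)}
    {G : (Fin n → ℝ) → Matrix (Fin m) (Fin m) ℝ} {x : Fin n → ℝ}
    (hf : DifferentiableAt ℝ f x) (hh : DifferentiableAt ℝ h x) (hG : DifferentiableAt ℝ G x)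
    (μ : Fin p → ℝ) (Ω : Matrix (Fin m) (Fin m) ℝ) (d : Fin n → ℝ) :
    ∑ i, gradLag f h G x μ Ω i * d i =
      fderiv ℝ f x d - ∑ j, fderiv ℝ h x d j * μ j - finner (fderiv ℝ G x d) Ω := by
  have hL : HasFDerivAt (fun y => Lag f h G y μ Ω)
      (fderiv ℝ f x - ∑ j, μ j • (ContinuousLinearMap.proj j).comp (fderiv ℝ h x)
        - (finnerCLM Ω).comp (fderiv ℝ G x)) x := by
    refine (hf.hasFDerivAt.sub (HasFDerivAt.fun_sum fun j _ => ?_)).sub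
      ((finnerCLM Ω).hasFDerivAt.comp x hG.hasFDerivAt)
    exact (hasFDerivAt_pi'.1 hh.hasFDerivAt j).mul_const (μ j)
  calc ∑ i, gradLag f h G x μ Ω i * d i
      = fderiv ℝ (fun y => Lag f h G y μ Ω) x d := by
        conv_rhs => rw [pi_eq_sum_univ' d, map_sum]
        exact Finset.sum_congr rfl fun i _ => by
          rw [map_smul, smul_eq_mul, mul_comm]; rfl
    _ = _ := by
        rw [hL.fderiv]
        simp [mul_comm]

/-- Limits of rescaled multipliers of an AKKT sequence satisfy the (Fritz John type)
optimality conditions. -/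
lemma IsAKKTSeq.limit_conditions {n p m : ℕ} {f : (Fin n → ℝ) → ℝ}
    {h : (Fin n → ℝ) → (Fin p → ℝ)} {G : (Fin n → ℝ) → Matrix (Fin m) (Fin m) ℝ}
    (hf : ContDiff ℝ 2 f) (hh : ContDiff ℝ 2 h) (hG : ContDiff ℝ 2 G)
    {xb : Fin n → ℝ} (hfeas : Feasible h G xb)
    {x : ℕ → Fin n → ℝ} {μ : ℕ → Fin p → ℝ} {Ω : ℕ → Matrix (Fin m) (Fin m) ℝ}
    (hseq : IsAKKTSeq f h G xb x μ Ω) {φ : ℕ → ℕ} (hφ : StrictMono φ)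
    {c : ℕ → ℝ} (hc : ∀ k, 0 ≤ c k) {cb : ℝ} {μb : Fin p → ℝ} {Ωb : Matrix (Fin m) (Fin m) ℝ}
    (hcb : Tendsto (fun k => c (φ k)) atTop (𝓝 cb))
    (hμb : Tendsto (fun k => c (φ k) • μ (φ k)) atTop (𝓝 μb))
    (hΩb : Tendsto (fun k => c (φ k) • Ω (φ k)) atTop (𝓝 Ωb)) :
    Ωb.PosSemidef ∧ finner (G xb) Ωb = 0 ∧
      ∀ d, cb * fderiv ℝ f xb d - ∑ j, fderiv ℝ h xb d j * μb j
        - finner (fderiv ℝ G xb d) Ωb = 0 := by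
  obtain ⟨hpsd, hx, hgrad, U, Uk, lam, lamk, hU, hUk, hUlim, hGU, hΩU, hcompl⟩ := hseq
  have hφt := hφ.tendsto_atTop
  refine ⟨isClosed_setOf_posSemidef.mem_of_tendsto hΩb
    (Eventually.of_forall fun k => (hpsd _).smul (hc _)), ?_, fun d => ?_⟩
  · have hdiag : Uᵀ * G xb * U = diagonal lam := by
      rw [hGU]
      calc Uᵀ * (U * diagonal lam * Uᵀ) * U = (Uᵀ * U) * diagonal lam * (Uᵀ * U) := by
            simp only [Matrix.mul_assoc]
        _ = diagonal lam := by simp [hU]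
    have hlam : ∀ j, 0 ≤ lam j := fun j => by
      have hps := hfeas.2.conjTranspose_mul_mul_same U
      rw [conjTranspose_eq_transpose_of_trivial, hdiag] at hps
      simpa using hps.diag_nonneg (i := j)
    have hentry : ∀ j, lam j * (Uᵀ * Ωb * U) j j = 0 := fun j => by
      rcases (hlam j).eq_or_lt with hj | hj
      · simp [← hj]
      obtain ⟨kj, hkj⟩ := hcompl j hj
      have hUφ : Tendsto (fun k => Uk (φ k)) atTop (𝓝 U) := hUlim.comp hφt
      have hcont : Continuous fun q : Matrix (Fin m) (Fin m) ℝ × Matrix (Fin m) (Fin m) ℝ =>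
          (q.1ᵀ * q.2 * q.1) j j := by fun_prop
      have hlim := (hcont.tendsto (U, Ωb)).comp (hUφ.prodMk_nhds hΩb)
      have hzero : ∀ᶠ k in atTop,
          ((Uk (φ k))ᵀ * (c (φ k) • Ω (φ k)) * Uk (φ k)) j j = 0 := by
        filter_upwards [hφt.eventually_ge_atTop kj] with k hk
        have hconj : (Uk (φ k))ᵀ * Ω (φ k) * Uk (φ k) = diagonal (lamk (φ k)) := by
          rw [hΩU]
          calc _ = ((Uk (φ k))ᵀ * Uk (φ k)) * diagonal (lamk (φ k)) *
                ((Uk (φ k))ᵀ * Uk (φ k)) := by simp only [Matrix.mul_assoc]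
            _ = _ := by simp [hUk]
        rw [Matrix.mul_smul, Matrix.smul_mul, hconj]
        simp [hkj _ hk]
      have := tendsto_nhds_unique hlim
        (tendsto_const_nhds.congr' (hzero.mono fun k hk => hk.symm))
      simpa using Or.inr this
    calc finner (G xb) Ωb = (diagonal lam * (Uᵀ * Ωb * U)).trace := by
          have hsymm : (G xb)ᵀ = U * diagonal lam * Uᵀ := by
            rw [hGU]; simp [Matrix.mul_assoc]
          rw [finner, hsymm, Matrix.mul_assoc, Matrix.mul_assoc, Matrix.trace_mul_comm]
          simp only [Matrix.mul_assoc]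
      _ = 0 := by simp [Matrix.trace, Matrix.diagonal_mul, hentry]
  · have hxφ : Tendsto (fun k => x (φ k)) atTop (𝓝 xb) := hx.comp hφt
    have h2 : (2 : WithTop ℕ∞) ≠ 0 := by norm_num
    have hfd : Tendsto (fun k => fderiv ℝ f (x (φ k)) d) atTop (𝓝 (fderiv ℝ f xb d)) :=
      (((hf.continuous_fderiv h2).clm_apply continuous_const).tendsto xb).comp hxφ
    have hhd : Tendsto (fun k => fderiv ℝ h (x (φ k)) d) atTop (𝓝 (fderiv ℝ h xb d)) :=
      (((hh.continuous_fderiv h2).clm_apply continuous_const).tendsto xb).comp hxφ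
    have hGd : Tendsto (fun k => fderiv ℝ G (x (φ k)) d) atTop (𝓝 (fderiv ℝ G xb d)) :=
      (((hG.continuous_fderiv h2).clm_apply continuous_const).tendsto xb).comp hxφ
    have hrhs := ((hcb.mul hfd).sub (tendsto_finsetSum Finset.univ fun j _ =>
      (tendsto_pi_nhds.1 hhd j).mul (tendsto_pi_nhds.1 hμb j))).sub
      ((finner_continuous.tendsto _).comp (hGd.prodMk_nhds hΩb))
    have hlhs : Tendsto (fun k => c (φ k) *
        ∑ i, gradLag f h G (x (φ k)) (μ (φ k)) (Ω (φ k)) i * d i) atTop (𝓝 0) := by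
      have := hcb.mul (tendsto_finsetSum Finset.univ fun i _ =>
        (tendsto_pi_nhds.1 (hgrad.comp hφt) i).mul_const (d i))
      simpa using this
    refine tendsto_nhds_unique hrhs (hlhs.congr fun k => ?_)
    rw [sum_gradLag_mul (hf.differentiable h2 _) (hh.differentiable h2 _)
      (hG.differentiable h2 _)]
    simp only [mul_sub, Finset.mul_sum, Function.comp_apply, finner_smul_right, Pi.smul_apply,
      smul_eq_mul]
    congr 2
    exact Finset.sum_congr rfl fun j _ => by ring

/-- Under Robinson's constraint qualification there are no nonzero singular multipliers. -/
lemma RobinsonCQ.multipliers_eq_zero {n p m : ℕ} {h : (Fin n → ℝ) → (Fin p → ℝ)}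
    {G : (Fin n → ℝ) → Matrix (Fin m) (Fin m) ℝ} {xb : Fin n → ℝ} (hRob : RobinsonCQ h G xb)
    {μ : Fin p → ℝ} {Ω : Matrix (Fin m) (Fin m) ℝ} (hΩ : Ω.PosSemidef)
    (hcompl : finner (G xb) Ω = 0)
    (hstat : ∀ d, ∑ j, fderiv ℝ h xb d j * μ j + finner (fderiv ℝ G xb d) Ω = 0) :
    μ = 0 ∧ Ω = 0 := by
  obtain ⟨hsurj, d, hd, hpd⟩ := hRob
  have hΩ0 : Ω = 0 := by
    refine hΩ.eq_zero_of_finner_posDef_eq_zero hpd ?_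
    have := hstat d
    rw [finner_add_left, hcompl]
    simpa [hd] using this
  refine ⟨?_, hΩ0⟩
  obtain ⟨e, he⟩ := hsurj μ
  have he' : fderiv ℝ h xb e = μ := he
  have := hstat e
  rw [he', hΩ0] at this
  exact dotProduct_self_eq_zero.1 (by simpa [finner, dotProduct] using this)

/-- At an AKKT point where Robinson's CQ holds, the multipliers of any
AKKT sequence have a convergent subsequence whose limit yields a KKT triple. -/
theorem stmt10 {n p m : ℕ} (f : (Fin n → ℝ) → ℝ) (h : (Fin n → ℝ) → (Fin p → ℝ))
    (G : (Fin n → ℝ) → Matrix (Fin m) (Fin m) ℝ)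
    (hf : ContDiff ℝ 2 f) (hh : ContDiff ℝ 2 h) (hG : ContDiff ℝ 2 G)
    (hsym : ∀ x, (G x).IsHermitian)
    (xb : Fin n → ℝ) (hfeas : Feasible h G xb)
    (x : ℕ → Fin n → ℝ) (μ : ℕ → Fin p → ℝ) (Ω : ℕ → Matrix (Fin m) (Fin m) ℝ)
    (hseq : IsAKKTSeq f h G xb x μ Ω)
    (hRob : RobinsonCQ h G xb) :
    ∃ (μb : Fin p → ℝ) (Ωb : Matrix (Fin m) (Fin m) ℝ) (φ : ℕ → ℕ),
      StrictMono φ ∧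
      Tendsto (fun j => μ (φ j)) atTop (𝓝 μb) ∧
      Tendsto (fun j => Ω (φ j)) atTop (𝓝 Ωb) ∧
      IsKKT f h G xb μb Ωb := by
  obtain ⟨c, hcdef⟩ : ∃ c : ℕ → ℝ, ∀ k, c k = (1 + ‖(μ k, Ω k)‖)⁻¹ := ⟨_, fun _ => rfl⟩
  have hcpos : ∀ k, 0 < c k := fun k => by rw [hcdef]; positivity
  have hcnorm : ∀ k, ‖c k • (μ k, Ω k)‖ = 1 - c k := fun k => by
    rw [norm_smul, Real.norm_of_nonneg (hcpos k).le, hcdef]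
    have : 1 + ‖(μ k, Ω k)‖ ≠ 0 := by positivity
    field_simp
    ring
  have hcle : ∀ k, c k ≤ 1 := fun k => by
    have := norm_nonneg (c k • (μ k, Ω k))
    rw [hcnorm] at this
    linarith
  obtain ⟨⟨cb, μ₀, Ω₀⟩, -, φ, hφ, hlim⟩ :=
    (isCompact_closedBall (0 : ℝ × (Fin p → ℝ) × Matrix (Fin m) (Fin m) ℝ) 1).tendsto_subseq
      (x := fun k => (c k, c k • (μ k, Ω k))) fun k => by
        rw [mem_closedBall_zero_iff, norm_prod_le_iff, hcnorm, Real.norm_of_nonneg (hcpos k).le]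
        exact ⟨hcle k, by linarith [hcpos k]⟩
  have hcb : Tendsto (fun k => c (φ k)) atTop (𝓝 cb) := (Prod.tendsto_iff _ _).1 hlim |>.1
  have hpair : Tendsto (fun k => c (φ k) • (μ (φ k), Ω (φ k))) atTop (𝓝 (μ₀, Ω₀)) :=
    (Prod.tendsto_iff _ _).1 hlim |>.2
  have hμ₀ : Tendsto (fun k => c (φ k) • μ (φ k)) atTop (𝓝 μ₀) :=
    (Prod.tendsto_iff _ _).1 hpair |>.1
  have hΩ₀ : Tendsto (fun k => c (φ k) • Ω (φ k)) atTop (𝓝 Ω₀) :=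
    (Prod.tendsto_iff _ _).1 hpair |>.2
  have hcb0 : cb ≠ 0 := by
    rintro rfl
    have hnorm : ‖(μ₀, Ω₀)‖ = 1 - 0 :=
      tendsto_nhds_unique hpair.norm
        ((tendsto_const_nhds.sub hcb).congr fun k => (hcnorm (φ k)).symm)
    obtain ⟨hpsd, hcompl, hstat⟩ :=
      hseq.limit_conditions hf hh hG hfeas hφ (fun k => (hcpos k).le) hcb hμ₀ hΩ₀
    obtain ⟨rfl, rfl⟩ := hRob.multipliers_eq_zero hpsd hcompl
      fun d => by linarith [hstat d]
    simp at hnorm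
  have hinv : Tendsto (fun k => (c (φ k))⁻¹) atTop (𝓝 cb⁻¹) := hcb.inv₀ hcb0
  have hμb : Tendsto (fun k => μ (φ k)) atTop (𝓝 (cb⁻¹ • μ₀)) :=
    (hinv.smul hμ₀).congr fun k => inv_smul_smul₀ (hcpos _).ne' _
  have hΩb : Tendsto (fun k => Ω (φ k)) atTop (𝓝 (cb⁻¹ • Ω₀)) :=
    (hinv.smul hΩ₀).congr fun k => inv_smul_smul₀ (hcpos _).ne' _
  obtain ⟨hpsd, hcompl, hstat⟩ := hseq.limit_conditions hf hh hG hfeas hφ (c := fun _ => 1)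
    (fun _ => zero_le_one) tendsto_const_nhds (by simpa using hμb) (by simpa using hΩb)
  refine ⟨_, _, φ, hφ, hμb, hΩb, hfeas, hpsd, ?_, hcompl⟩
  have h2 : (2 : WithTop ℕ∞) ≠ 0 := by norm_num
  ext i
  have hi := sum_gradLag_mul (hf.differentiable h2 xb) (hh.differentiable h2 xb)
    (hG.differentiable h2 xb) (cb⁻¹ • μ₀) (cb⁻¹ • Ω₀) (Pi.single i 1)
  have hs := hstat (Pi.single i 1)
  rw [one_mul] at hs
  rw [hs] at hi
  simpa [Pi.single_apply] using hi

end
end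

section
/- Let x* ∈ ℝⁿ, δ > 0, and let ψ be a continuous function on the closed ball B(x*, δ) such that P(x) ≤ ψ(x)‖∇P(x)‖ for all x ∈ B(x*, δ). Then for every x ∈ B(x*, δ), every ρ > 0 and every ε ≥ 0 such that ‖∇f(x) + ρ∇P(x)‖ ≤ ε, it holds that ρ P(x) ≤ ψ(x)(ε + ‖∇f(x)‖). In particular, if xᵏ → x* with xᵏ ∈ B(x*, δ) eventually, ρₖ → ∞, εₖ → 0, ψ(xᵏ) → 0 and ‖∇f(xᵏ) + ρₖ∇P(xᵏ)‖ ≤ εₖ for all k, then ρₖ‖h(xᵏ)‖² → 0 and ρₖ‖Π_{Sᵐ₊}(−G(xᵏ))‖_F² → 0; consequently h(x*) = 0 and G(x*) ⪰ 0. -/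
open Matrix Filter Topology Set

attribute [local instance] Matrix.normedAddCommGroup Matrix.normedSpace

noncomputable section

/-- The Euclidean norm is the norm of `EuclideanSpace`. -/
lemma euclNorm_eq_norm_toLp {n : ℕ} (v : Fin n → ℝ) : euclNorm v = ‖WithLp.toLp 2 v‖ := by
  simp [euclNorm, euclNormSq, EuclideanSpace.norm_eq]

lemma continuous_euclNorm {n : ℕ} : Continuous (euclNorm : (Fin n → ℝ) → ℝ) := by
  unfold euclNorm euclNormSq
  fun_prop

/-- Reverse triangle inequality for a positive multiple. -/
lemma mul_euclNorm_le {n : ℕ} (u v : Fin n → ℝ) {ρ : ℝ} (hρ : 0 < ρ) :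
    ρ * euclNorm v ≤ euclNorm (u + ρ • v) + euclNorm u := by
  simp only [euclNorm_eq_norm_toLp, WithLp.toLp_add, WithLp.toLp_smul]
  have key := norm_sub_le (WithLp.toLp 2 u + ρ • WithLp.toLp 2 v) (WithLp.toLp 2 u)
  rwa [add_sub_cancel_left, norm_smul, Real.norm_of_nonneg hρ.le] at key

lemma continuous_grad {n : ℕ} {f : (Fin n → ℝ) → ℝ} (hf : ContDiff ℝ 1 f) :
    Continuous (grad f) :=
  continuous_pi fun _ => (hf.continuous_fderiv one_ne_zero).clm_apply continuous_const

lemma frobSq_eq_sum {m : ℕ} (A : Matrix (Fin m) (Fin m) ℝ) :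
    frobSq A = ∑ j, ∑ i, A i j ^ 2 := by
  simp [frobSq, finner, Matrix.trace, Matrix.mul_apply, sq]

lemma frobSq_nonneg {m : ℕ} (A : Matrix (Fin m) (Fin m) ℝ) : 0 ≤ frobSq A := by
  rw [frobSq_eq_sum]
  positivity

lemma sq_apply_le_frobSq {m : ℕ} (A : Matrix (Fin m) (Fin m) ℝ) (i j : Fin m) :
    A i j ^ 2 ≤ frobSq A := by
  rw [frobSq_eq_sum]
  calc A i j ^ 2 ≤ ∑ i, A i j ^ 2 :=
        Finset.single_le_sum (f := fun i => A i j ^ 2) (fun _ _ => sq_nonneg _)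
          (Finset.mem_univ i)
    _ ≤ _ := Finset.single_le_sum (f := fun j => ∑ i, A i j ^ 2)
          (fun _ _ => Finset.sum_nonneg fun _ _ => sq_nonneg _) (Finset.mem_univ j)

/-- A sequence of matrices whose Frobenius norms tend to zero tends to zero. -/
lemma tendsto_zero_of_frobSq {m : ℕ} {A : ℕ → Matrix (Fin m) (Fin m) ℝ}
    (hA : Tendsto (fun k => frobSq (A k)) atTop (𝓝 0)) : Tendsto A atTop (𝓝 0) := by
  refine tendsto_pi_nhds.2 fun i => tendsto_pi_nhds.2 fun j => ?_
  have hsq : Tendsto (fun k => A k i j ^ 2) atTop (𝓝 0) :=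
    squeeze_zero (fun _ => sq_nonneg _) (fun k => sq_apply_le_frobSq (A k) i j) hA
  refine (tendsto_zero_iff_abs_tendsto_zero _).2 ?_
  simpa [Function.comp_def, Real.sqrt_sq_eq_abs] using hsq.sqrt

/-- `Π(M) - M` is positive semidefinite for symmetric `M`. -/
lemma posSemidef_psdProj_sub {m : ℕ} {M : Matrix (Fin m) (Fin m) ℝ} (hM : M.IsHermitian) :
    (psdProj M - M).PosSemidef := by
  have hspec : M = (hM.eigenvectorUnitary : Matrix (Fin m) (Fin m) ℝ) *
      diagonal hM.eigenvalues * star (hM.eigenvectorUnitary : Matrix (Fin m) (Fin m) ℝ) := by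
    simpa [Unitary.conjStarAlgAut_apply, Function.comp_def] using hM.spectral_theorem
  have heq : psdProj M - M = (hM.eigenvectorUnitary : Matrix (Fin m) (Fin m) ℝ) *
      diagonal (fun i => max (hM.eigenvalues i) 0 - hM.eigenvalues i) *
      (hM.eigenvectorUnitary : Matrix (Fin m) (Fin m) ℝ)ᴴ := by
    rw [psdProj, dif_pos hM]
    conv_lhs => arg 2; rw [hspec]
    rw [← Matrix.sub_mul, ← Matrix.mul_sub, Matrix.diagonal_sub, Matrix.star_eq_conjTranspose]
  rw [heq]
  exact (Matrix.PosSemidef.diagonal fun i =>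
    sub_nonneg.2 (le_max_left _ _)).mul_mul_conjTranspose_same _

/-- Positive semidefiniteness passes to limits. -/
lemma posSemidef_of_tendsto {m : ℕ} {A : ℕ → Matrix (Fin m) (Fin m) ℝ}
    {B : Matrix (Fin m) (Fin m) ℝ} (hA : ∀ k, (A k).PosSemidef)
    (hAB : Tendsto A atTop (𝓝 B)) : B.PosSemidef := by
  refine Matrix.PosSemidef.of_dotProduct_mulVec_nonneg ?_ fun v => ?_
  · refine tendsto_nhds_unique (f := fun k => (A k)ᴴ) (l := atTop) ?_ ?_
    · exact (continuous_id.matrix_conjTranspose.tendsto B).comp hAB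
    · simpa only [fun k => (hA k).isHermitian.eq] using hAB
  · have hc : Continuous fun M : Matrix (Fin m) (Fin m) ℝ => star v ⬝ᵥ (M *ᵥ v) := by fun_prop
    exact ge_of_tendsto' ((hc.tendsto B).comp hAB) fun k => (hA k).dotProduct_mulVec_nonneg v

/-- If `ρ * u` tends to zero while `ρ` tends to infinity, then `u` tends to zero. -/
lemma tendsto_zero_of_mul_tendsto_zero {ρ u : ℕ → ℝ} (hρ : Tendsto ρ atTop atTop)
    (hu : Tendsto (fun k => ρ k * u k) atTop (𝓝 0)) : Tendsto u atTop (𝓝 0) := by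
  have hprod := hρ.inv_tendsto_atTop.mul hu
  rw [zero_mul] at hprod
  refine hprod.congr' ?_
  filter_upwards [hρ.eventually_gt_atTop 0] with k hk
  simp [inv_mul_cancel_left₀ hk.ne']

/-- A quantitative consequence of the generalized KL inequality for the
penalty function, and the resulting feasibility of accumulation points. -/
theorem stmt17 {n p m : ℕ} (f : (Fin n → ℝ) → ℝ) (h : (Fin n → ℝ) → (Fin p → ℝ))
    (G : (Fin n → ℝ) → Matrix (Fin m) (Fin m) ℝ)
    (hf : ContDiff ℝ 2 f) (hh : ContDiff ℝ 2 h) (hG : ContDiff ℝ 2 G)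
    (hsym : ∀ x, (G x).IsHermitian)
    (xs : Fin n → ℝ) (δ : ℝ) (hδ : 0 < δ) (ψ : (Fin n → ℝ) → ℝ)
    (hψc : ContinuousOn ψ {y | euclNorm (y - xs) ≤ δ})
    (hψnn : ∀ y, euclNorm (y - xs) ≤ δ → 0 ≤ ψ y)
    (hKL : ∀ y, euclNorm (y - xs) ≤ δ →
      constraintViol h G y ≤ ψ y * euclNorm (gradPen h G y)) :
    (∀ y, euclNorm (y - xs) ≤ δ → ∀ ρ : ℝ, 0 < ρ → ∀ ε : ℝ, 0 ≤ ε →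
      euclNorm (grad f y + ρ • gradPen h G y) ≤ ε →
      ρ * constraintViol h G y ≤ ψ y * (ε + euclNorm (grad f y))) ∧
    (∀ (x : ℕ → Fin n → ℝ) (ρ ε : ℕ → ℝ),
      Tendsto x atTop (𝓝 xs) → (∀ᶠ k in atTop, euclNorm (x k - xs) ≤ δ) →
      Tendsto ρ atTop atTop → (∀ k, 0 < ρ k) → Tendsto ε atTop (𝓝 0) →
      Tendsto (fun k => ψ (x k)) atTop (𝓝 0) →
      (∀ k, euclNorm (grad f (x k) + ρ k • gradPen h G (x k)) ≤ ε k) →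
      Tendsto (fun k => ρ k * ∑ j, (h (x k) j)^2) atTop (𝓝 0) ∧
      Tendsto (fun k => ρ k * frobSq (psdProj (-(G (x k))))) atTop (𝓝 0) ∧
      h xs = 0 ∧ (G xs).PosSemidef) := by
  have bound : ∀ y, euclNorm (y - xs) ≤ δ → ∀ ρ : ℝ, 0 < ρ → ∀ ε : ℝ,
      euclNorm (grad f y + ρ • gradPen h G y) ≤ ε →
      ρ * constraintViol h G y ≤ ψ y * (ε + euclNorm (grad f y)) := by
    intro y hy ρ hρ ε hle
    calc ρ * constraintViol h G y ≤ ρ * (ψ y * euclNorm (gradPen h G y)) :=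
          mul_le_mul_of_nonneg_left (hKL y hy) hρ.le
      _ = ψ y * (ρ * euclNorm (gradPen h G y)) := by ring
      _ ≤ ψ y * (ε + euclNorm (grad f y)) :=
          mul_le_mul_of_nonneg_left
            ((mul_euclNorm_le _ _ hρ).trans (by gcongr)) (hψnn y hy)
  refine ⟨fun y hy ρ hρ ε _ => bound y hy ρ hρ ε, ?_⟩
  intro x ρ ε hx hball hρ hρpos hε hψ hstat
  have hgrad : Tendsto (fun k => euclNorm (grad f (x k))) atTop (𝓝 (euclNorm (grad f xs))) :=
    ((continuous_euclNorm.comp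
      (continuous_grad (hf.of_le one_le_two))).tendsto xs).comp hx
  have hmajor : Tendsto (fun k => 2 * (ψ (x k) * (ε k + euclNorm (grad f (x k)))))
      atTop (𝓝 0) := by
    simpa using (hψ.mul (hε.add hgrad)).const_mul 2
  have hsum : ∀ k, 0 ≤ ∑ j, (h (x k) j) ^ 2 := fun k => by positivity
  have hfrob : ∀ k, 0 ≤ frobSq (psdProj (-(G (x k)))) := fun k => frobSq_nonneg _
  have hle : ∀ᶠ k in atTop,
      ρ k * (∑ j, (h (x k) j) ^ 2) + ρ k * frobSq (psdProj (-(G (x k)))) ≤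
        2 * (ψ (x k) * (ε k + euclNorm (grad f (x k)))) := by
    filter_upwards [hball] with k hk
    have hb := bound (x k) hk (ρ k) (hρpos k) (ε k) (hstat k)
    unfold constraintViol at hb
    linarith
  have hlimh : Tendsto (fun k => ρ k * ∑ j, (h (x k) j) ^ 2) atTop (𝓝 0) := by
    refine squeeze_zero' (.of_forall fun k => mul_nonneg (hρpos k).le (hsum k)) ?_ hmajor
    filter_upwards [hle] with k hk
    linarith [mul_nonneg (hρpos k).le (hfrob k)]
  have hlimG : Tendsto (fun k => ρ k * frobSq (psdProj (-(G (x k))))) atTop (𝓝 0) := by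
    refine squeeze_zero' (.of_forall fun k => mul_nonneg (hρpos k).le (hfrob k)) ?_ hmajor
    filter_upwards [hle] with k hk
    linarith [mul_nonneg (hρpos k).le (hsum k)]
  refine ⟨hlimh, hlimG, ?_, ?_⟩
  · have hcont : Continuous fun y => ∑ j, (h y j) ^ 2 := by
      have := hh.continuous
      fun_prop
    have hzero : ∑ j, (h xs j) ^ 2 = 0 :=
      tendsto_nhds_unique ((hcont.tendsto xs).comp hx) (tendsto_zero_of_mul_tendsto_zero hρ hlimh)
    funext j
    simpa using (Finset.sum_eq_zero_iff_of_nonneg fun j _ => sq_nonneg (h xs j)).1 hzero j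
      (Finset.mem_univ j)
  · refine posSemidef_of_tendsto (A := fun k => psdProj (-(G (x k))) - -(G (x k)))
      (fun k => posSemidef_psdProj_sub (hsym (x k)).neg) ?_
    simpa using (tendsto_zero_of_frobSq (tendsto_zero_of_mul_tendsto_zero hρ hlimG)).sub
      ((hG.continuous.tendsto xs).comp hx).neg

end
end
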